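/- arXiv:1807.09654 — 10 statements merged into one kernel-verified Lean document; each statement's English description precedes it below -/
import Mathlib

section
/- Fix real numbers κ, τ and β ∈ (0,1), and let I_β = {ρ > 0 : 4+κρ² > 0 and 1−β²(1+τ²ρ²) > 0}, a nonempty open interval with left endpoint 0. Let u be an antiderivative on I_β of the function ρ ↦ (4/β)·√(1−β²(1+τ²ρ²))/(4+κρ²) (the profile of the cone C_β in E³(κ,τ)). Then, with ν, H, K_e associated to u as in the context: (1) ν(ρ) = β for every ρ ∈ I_β; (2) K_e(ρ) = −τ² for every ρ ∈ I_β; (3) H is strictly decreasing on I_β. -/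
open Set Filter Topology

/-- `D(ρ) = u'(ρ)²(4+κρ²)² + 16(1+τ²ρ²)`. -/
noncomputable def Dfun (κ τ : ℝ) (u : ℝ → ℝ) (ρ : ℝ) : ℝ :=
  (deriv u ρ) ^ 2 * (4 + κ * ρ ^ 2) ^ 2 + 16 * (1 + τ ^ 2 * ρ ^ 2)

/-- The angle function `ν(ρ) = 4/√(D(ρ))` of the rotational graph `x₃ = u(√(x₁²+x₂²))`
in the coordinate model of `E³(κ,τ)`. -/
noncomputable def angleFn (κ τ : ℝ) (u : ℝ → ℝ) (ρ : ℝ) : ℝ :=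
  4 / Real.sqrt (Dfun κ τ u ρ)

/-- The mean curvature `H(ρ)` of the rotational graph `x₃ = u(√(x₁²+x₂²))`. -/
noncomputable def meanCurv (κ τ : ℝ) (u : ℝ → ℝ) (ρ : ℝ) : ℝ :=
  (4 + κ * ρ ^ 2) ^ 2 *
      (-κ ^ 2 * ρ ^ 4 * (deriv u ρ) ^ 3 + 16 * deriv u ρ * ((deriv u ρ) ^ 2 + 1)
        + 16 * ρ * (1 + τ ^ 2 * ρ ^ 2) * deriv (deriv u) ρ)
    / (8 * ρ * Real.sqrt (Dfun κ τ u ρ) ^ 3)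

/-- The extrinsic curvature `K_e(ρ)` of the rotational graph `x₃ = u(√(x₁²+x₂²))`. -/
noncomputable def extCurv (κ τ : ℝ) (u : ℝ → ℝ) (ρ : ℝ) : ℝ :=
  deriv u ρ * (4 + κ * ρ ^ 2) ^ 2 * (4 - (κ - 8 * τ ^ 2) * ρ ^ 2) *
      (deriv (deriv u) ρ * (4 + κ * ρ ^ 2) + 2 * ρ * (κ - 4 * τ ^ 2) * deriv u ρ)
    / (ρ * (Dfun κ τ u ρ) ^ 2)
  - τ ^ 2 * ((deriv u ρ) ^ 2 * (4 + κ * ρ ^ 2) ^ 2 + 4 * ρ ^ 2 * (κ - 4 * τ ^ 2)) ^ 2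
    / (Dfun κ τ u ρ) ^ 2

/-- The domain `I_β` of the profile of the cone `C_β`. -/
def coneDomain (κ τ β : ℝ) : Set ℝ :=
  {ρ : ℝ | 0 < ρ ∧ 0 < 4 + κ * ρ ^ 2 ∧ 0 < 1 - β ^ 2 * (1 + τ ^ 2 * ρ ^ 2)}

/-- The function `s(ρ) = √(1 - β²(1+τ²ρ²))`. -/
noncomputable def coneRoot (τ β ρ : ℝ) : ℝ :=
  Real.sqrt (1 - β ^ 2 * (1 + τ ^ 2 * ρ ^ 2))

/-- The derivative of the profile of the cone `C_β`. -/
noncomputable def coneSlope (κ τ β ρ : ℝ) : ℝ :=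
  (4 / β) * coneRoot τ β ρ / (4 + κ * ρ ^ 2)

lemma isOpen_coneDomain (κ τ β : ℝ) : IsOpen (coneDomain κ τ β) := by
  have hw : Continuous fun ρ : ℝ => 4 + κ * ρ ^ 2 := by fun_prop
  have hs : Continuous fun ρ : ℝ => 1 - β ^ 2 * (1 + τ ^ 2 * ρ ^ 2) := by fun_prop
  exact (isOpen_lt continuous_const continuous_id).inter
    ((isOpen_lt continuous_const hw).inter (isOpen_lt continuous_const hs))

section

variable {κ τ β ρ : ℝ}

lemma coneRoot_pos (hρ : ρ ∈ coneDomain κ τ β) : 0 < coneRoot τ β ρ :=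
  Real.sqrt_pos.2 hρ.2.2

lemma coneRoot_sq (hρ : ρ ∈ coneDomain κ τ β) :
    coneRoot τ β ρ ^ 2 = 1 - β ^ 2 * (1 + τ ^ 2 * ρ ^ 2) :=
  Real.sq_sqrt hρ.2.2.le

lemma hasDerivAt_coneRoot (hρ : ρ ∈ coneDomain κ τ β) :
    HasDerivAt (coneRoot τ β) (-(β ^ 2 * τ ^ 2 * ρ) / coneRoot τ β ρ) ρ := by
  have h : HasDerivAt (fun x : ℝ => 1 - β ^ 2 * (1 + τ ^ 2 * x ^ 2))
      (-(β ^ 2 * (τ ^ 2 * (2 * ρ)))) ρ := by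
    simpa using ((((hasDerivAt_pow 2 ρ).const_mul (τ ^ 2)).const_add 1).const_mul
      (β ^ 2)).const_sub 1
  refine (h.sqrt hρ.2.2.ne').congr_deriv ?_
  change _ / (2 * coneRoot τ β ρ) = _
  have := (coneRoot_pos hρ).ne'
  field_simp

lemma hasDerivAt_coneSlope (hβ : β ≠ 0) (hρ : ρ ∈ coneDomain κ τ β) :
    HasDerivAt (coneSlope κ τ β)
      ((4 / β) * (-(β ^ 2 * τ ^ 2 * ρ) / (coneRoot τ β ρ * (4 + κ * ρ ^ 2))
        - 2 * κ * ρ * coneRoot τ β ρ / (4 + κ * ρ ^ 2) ^ 2)) ρ := by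
  have hw : HasDerivAt (fun x : ℝ => 4 + κ * x ^ 2) (κ * (2 * ρ)) ρ := by
    simpa using ((hasDerivAt_pow 2 ρ).const_mul κ).const_add 4
  refine (((hasDerivAt_coneRoot hρ).const_mul (4 / β)).div hw hρ.2.1.ne').congr_deriv ?_
  have hs := (coneRoot_pos hρ).ne'
  have hw' := hρ.2.1.ne'
  field_simp

variable {u : ℝ → ℝ}

lemma deriv_deriv_cone (hβ : β ≠ 0)
    (hu : ∀ x ∈ coneDomain κ τ β, HasDerivAt u (coneSlope κ τ β x) x)
    (hρ : ρ ∈ coneDomain κ τ β) :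
    deriv (deriv u) ρ =
      (4 / β) * (-(β ^ 2 * τ ^ 2 * ρ) / (coneRoot τ β ρ * (4 + κ * ρ ^ 2))
        - 2 * κ * ρ * coneRoot τ β ρ / (4 + κ * ρ ^ 2) ^ 2) := by
  have h : deriv u =ᶠ[𝓝 ρ] coneSlope κ τ β := by
    filter_upwards [(isOpen_coneDomain κ τ β).mem_nhds hρ] with x hx
    exact (hu x hx).deriv
  rw [h.deriv_eq, (hasDerivAt_coneSlope hβ hρ).deriv]

lemma Dfun_cone (hβ : β ≠ 0) (hρ : ρ ∈ coneDomain κ τ β)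
    (hu : HasDerivAt u (coneSlope κ τ β ρ) ρ) :
    Dfun κ τ u ρ = (4 / β) ^ 2 := by
  rw [Dfun, hu.deriv, coneSlope]
  have hw := hρ.2.1.ne'
  have hs := coneRoot_sq hρ
  field_simp
  rw [hs]
  ring

lemma extCurv_cone (hβ : β ≠ 0)
    (hu : ∀ x ∈ coneDomain κ τ β, HasDerivAt u (coneSlope κ τ β x) x)
    (hρ : ρ ∈ coneDomain κ τ β) :
    extCurv κ τ u ρ = -τ ^ 2 := by
  rw [extCurv, Dfun_cone hβ hρ (hu ρ hρ), deriv_deriv_cone hβ hu hρ, (hu ρ hρ).deriv, coneSlope]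
  have hρ0 := hρ.1.ne'
  have hw := hρ.2.1.ne'
  have hs0 := (coneRoot_pos hρ).ne'
  have hs := coneRoot_sq hρ
  generalize coneRoot τ β ρ = s at *
  have first : 4 / β * s / (4 + κ * ρ ^ 2) * (4 + κ * ρ ^ 2) ^ 2 *
      (4 - (κ - 8 * τ ^ 2) * ρ ^ 2) *
      (4 / β * (-(β ^ 2 * τ ^ 2 * ρ) / (s * (4 + κ * ρ ^ 2))
        - 2 * κ * ρ * s / (4 + κ * ρ ^ 2) ^ 2) * (4 + κ * ρ ^ 2)
        + 2 * ρ * (κ - 4 * τ ^ 2) * (4 / β * s / (4 + κ * ρ ^ 2)))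
      / (ρ * ((4 / β) ^ 2) ^ 2) =
      -(β ^ 2 * τ ^ 2 / 16) * (β ^ 2 * (4 + κ * ρ ^ 2) + 8 * s ^ 2)
        * (4 - (κ - 8 * τ ^ 2) * ρ ^ 2) := by
    field_simp
    ring
  have second : (4 / β * s / (4 + κ * ρ ^ 2)) ^ 2 * (4 + κ * ρ ^ 2) ^ 2 = 16 * s ^ 2 / β ^ 2 := by
    field_simp
    ring
  rw [first, second, hs]
  field_simp
  ring

lemma meanCurv_cone (hβ : 0 < β)
    (hu : ∀ x ∈ coneDomain κ τ β, HasDerivAt u (coneSlope κ τ β x) x)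
    (hρ : ρ ∈ coneDomain κ τ β) :
    meanCurv κ τ u ρ = (4 / (ρ / coneRoot τ β ρ)
      - (4 * β ^ 2 * τ ^ 2 + κ * (1 - β ^ 2)) * (ρ / coneRoot τ β ρ)) / 8 := by
  have hβ' := hβ.ne'
  rw [meanCurv, Dfun_cone hβ' hρ (hu ρ hρ), Real.sqrt_sq (by positivity),
    deriv_deriv_cone hβ' hu hρ, (hu ρ hρ).deriv, coneSlope]
  have hρ0 := hρ.1.ne'
  have hw := hρ.2.1.ne'
  have hs0 := (coneRoot_pos hρ).ne'
  have hs := coneRoot_sq hρ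
  generalize coneRoot τ β ρ = s at *
  have hs4 : s ^ 4 = (1 - β ^ 2 * (1 + τ ^ 2 * ρ ^ 2)) ^ 2 := by rw [← hs]; ring
  field_simp
  ring_nf
  simp only [hs, hs4]
  ring

lemma coneRoot_ratio_lt {x y : ℝ} (hx : x ∈ coneDomain κ τ β) (hy : y ∈ coneDomain κ τ β)
    (hxy : x < y) : x / coneRoot τ β x < y / coneRoot τ β y := by
  have hx0 : 0 < x := hx.1
  have hle : coneRoot τ β y ≤ coneRoot τ β x := by
    unfold coneRoot
    gcongr
  exact div_lt_div₀ hxy hle hy.1.le (coneRoot_pos hy)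

lemma cone_ratio_bound (hβ0 : 0 < β) (hβ1 : β < 1) (hρ : ρ ∈ coneDomain κ τ β) :
    0 < 4 + (4 * β ^ 2 * τ ^ 2 + κ * (1 - β ^ 2)) * (ρ / coneRoot τ β ρ) ^ 2 := by
  have hs0 := coneRoot_pos hρ
  have hs := coneRoot_sq hρ
  have hw := hρ.2.1
  have hc : 0 < 1 - β ^ 2 := by nlinarith
  have key : 4 + (4 * β ^ 2 * τ ^ 2 + κ * (1 - β ^ 2)) * (ρ / coneRoot τ β ρ) ^ 2
      = (1 - β ^ 2) * (4 + κ * ρ ^ 2) / coneRoot τ β ρ ^ 2 := by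
    field_simp
    rw [hs]
    ring
  rw [key]
  positivity

end

/-- If `4 + m b² > 0` then `g ↦ 4/g - m g` satisfies `f b < f a` for `0 < a < b`. -/
lemma four_div_sub_mul_lt {m a b : ℝ} (ha : 0 < a) (hab : a < b) (hb : 0 < 4 + m * b ^ 2) :
    4 / b - m * b < 4 / a - m * a := by
  have hb0 : 0 < b := ha.trans hab
  have hm : 0 < 4 + m * (a * b) := by
    rcases le_or_gt 0 m with h | h
    · positivity
    · nlinarith [mul_pos hb0 (sub_pos.2 hab)]
  have key : (4 / a - m * a) - (4 / b - m * b) = (b - a) * (4 + m * (a * b)) / (a * b) := by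
    field_simp
    ring
  have := div_pos (mul_pos (sub_pos.2 hab) hm) (mul_pos ha hb0)
  linarith

/-- The cone `C_β` in `E³(κ,τ)` has constant angle function `β`, constant extrinsic
curvature `-τ²`, and strictly decreasing mean curvature. -/
theorem cone_properties (κ τ β : ℝ) (hβ0 : 0 < β) (hβ1 : β < 1)
    (Iβ : Set ℝ)
    (hIβ : Iβ = {ρ : ℝ | 0 < ρ ∧ 0 < 4 + κ * ρ ^ 2 ∧ 0 < 1 - β ^ 2 * (1 + τ ^ 2 * ρ ^ 2)})
    (u : ℝ → ℝ)
    (hu : ∀ ρ ∈ Iβ, HasDerivAt u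
      ((4 / β) * Real.sqrt (1 - β ^ 2 * (1 + τ ^ 2 * ρ ^ 2)) / (4 + κ * ρ ^ 2)) ρ) :
    (∀ ρ ∈ Iβ, angleFn κ τ u ρ = β) ∧
    (∀ ρ ∈ Iβ, extCurv κ τ u ρ = -τ ^ 2) ∧
    StrictAntiOn (meanCurv κ τ u) Iβ := by
  subst hIβ
  change ∀ ρ ∈ coneDomain κ τ β, HasDerivAt u (coneSlope κ τ β ρ) ρ at hu
  change (∀ ρ ∈ coneDomain κ τ β, _) ∧ (∀ ρ ∈ coneDomain κ τ β, _) ∧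
    StrictAntiOn _ (coneDomain κ τ β)
  refine ⟨fun ρ hρ => ?_, fun ρ hρ => extCurv_cone hβ0.ne' hu hρ, fun x hx y hy hxy => ?_⟩
  · rw [angleFn, Dfun_cone hβ0.ne' hρ (hu ρ hρ), Real.sqrt_sq (by positivity)]
    field_simp
  · rw [meanCurv_cone hβ0 hu hx, meanCurv_cone hβ0 hu hy]
    have h := four_div_sub_mul_lt (div_pos hx.1 (coneRoot_pos hx))
      (coneRoot_ratio_lt hx hy hxy) (cone_ratio_bound hβ0 hβ1 hy)
    linarith
end

section
/- Let I = (a,b) with −∞ ≤ a < b ≤ +∞ and let f : I → ℝ be a C^∞ function with f'(x) < 0 for all x ∈ I, f(I) = I and f(f(x)) = x for all x ∈ I, and such that: if a > −∞ then b = +∞ and f(x) → +∞ as x → a⁺, and if b < +∞ then a = −∞ and f(x) → −∞ as x → b⁻. Let 0 < s* ≤ +∞ and let r, h : [0,s*) → ℝ be C^∞ functions satisfying r'(s)² + h'(s)² = 1 for all s, r(0) = h(0) = h'(0) = 0, r'(0) = 1, r(s) > 0, r'(s) > 0 and h'(s) > 0 for every s ∈ (0,s*), and with r' strictly decreasing on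 [0,s*). For s ∈ (0,s*) set κ₁(s) = r'(s)h''(s) − r''(s)h'(s) and κ₂(s) = h'(s)·cosh(r(s))/sinh(r(s)), and assume that κ₂(s) ∈ I and κ₁(s) = f(κ₂(s)) for every s ∈ (0,s*). Then there exists a constant C such that κ₁(s)² + κ₂(s)² ≤ C for all s ∈ (0,s*). -/
open Set Filter Topology

/-- On a half-open interval `J` starting at `0`, derivatives within `J` and within `[0, ∞)` agree,
so the latter inherit smoothness on `J`. -/
lemma contDiffOn_derivWithin_Ici {J : Set ℝ}
    (hJ : (∃ sStar : ℝ, 0 < sStar ∧ J = Set.Ico 0 sStar) ∨ J = Set.Ici 0)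
    {g : ℝ → ℝ} (hg : ContDiffOn ℝ (⊤ : ℕ∞) g J) :
    ContDiffOn ℝ (⊤ : ℕ∞) (derivWithin g (Set.Ici 0)) J := by
  rcases hJ with ⟨S, hS, rfl⟩ | rfl
  · refine (hg.derivWithin (m := (⊤ : ℕ∞)) (uniqueDiffOn_Ico 0 S) (by simp)).congr ?_
    intro s hs
    refine (derivWithin_congr_set (eventuallyEq_set.2 ?_)).symm
    filter_upwards [Iio_mem_nhds hs.2] with t ht
    exact ⟨fun h => h.1, fun h => ⟨h, ht⟩⟩
  · exact hg.derivWithin (uniqueDiffOn_Ici 0) (by simp)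

lemma mem_nhds_of_pos {J : Set ℝ}
    (hJ : (∃ sStar : ℝ, 0 < sStar ∧ J = Set.Ico 0 sStar) ∨ J = Set.Ici 0)
    {s : ℝ} (hs : s ∈ J) (hs0 : 0 < s) : J ∈ 𝓝 s := by
  rcases hJ with ⟨S, hS, rfl⟩ | rfl
  · exact Ico_mem_nhds hs0 hs.2
  · exact Ici_mem_nhds hs0

lemma hasDerivAt_derivWithin_Ici {J : Set ℝ}
    (hJ : (∃ sStar : ℝ, 0 < sStar ∧ J = Set.Ico 0 sStar) ∨ J = Set.Ici 0)
    {g : ℝ → ℝ} (hg : ContDiffOn ℝ (⊤ : ℕ∞) g J) {s : ℝ} (hs : s ∈ J) (hs0 : 0 < s) :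
    HasDerivAt g (derivWithin g (Set.Ici 0) s) s := by
  rw [derivWithin_of_mem_nhds (Ici_mem_nhds hs0)]
  exact ((hg.contDiffAt (mem_nhds_of_pos hJ hs hs0)).differentiableAt (by simp)).hasDerivAt

/-- A function which starts above the level `m` and has positive derivative whenever it
equals `m` stays above `m`. -/
lemma le_of_hasDerivAt_pos_at_level {k k' : ℝ → ℝ} {m u v : ℝ} (huv : u ≤ v)
    (hk : ∀ s ∈ Icc u v, HasDerivAt k (k' s) s) (hu : m ≤ k u)
    (hm : ∀ s ∈ Icc u v, k s = m → 0 < k' s) : m ≤ k v := by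
  have key := image_le_of_deriv_right_lt_deriv_boundary (f := fun s => -k s)
    (f' := fun s => -k' s) (B := fun _ => -m) (B' := fun _ => 0) (a := u) (b := v)
    (fun s hs => (hk s hs).continuousAt.neg.continuousWithinAt)
    (fun s hs => (hk s (Ico_subset_Icc_self hs)).neg.hasDerivWithinAt)
    (by simpa using hu) (fun s => hasDerivAt_const s _)
    (fun s hs heq => by
      have := hm s (Ico_subset_Icc_self hs) (neg_injective heq)
      simpa using this)
  simpa using key (right_mem_Icc.2 huv)

/-- The principal curvature `κ₂ = h' coth r` increases where it does not exceed
`κ₁ = h'' / r'`. -/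
lemma coth_curvature_deriv_pos {r R H H2 k₁ : ℝ} (hr : 0 < r) (hR : 0 < R) (hH : 0 < H)
    (hk : R * k₁ = H2) (hle : H * Real.cosh r / Real.sinh r ≤ k₁) :
    0 < ((H2 * Real.cosh r + H * (Real.sinh r * R)) * Real.sinh r
      - H * Real.cosh r * (Real.cosh r * R)) / Real.sinh r ^ 2 := by
  have hsh : 0 < Real.sinh r := Real.sinh_pos_iff.2 hr
  have hch : 0 < Real.cosh r := Real.cosh_pos r
  have hle' : H * Real.cosh r ≤ k₁ * Real.sinh r := (div_le_iff₀ hsh).1 hle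
  refine div_pos ?_ (pow_pos hsh 2)
  have h1 : 0 ≤ R * Real.cosh r * (k₁ * Real.sinh r - H * Real.cosh r) :=
    mul_nonneg (mul_pos hR hch).le (sub_nonneg.2 hle')
  have h2 : 0 < H * R * Real.sinh r ^ 2 := by positivity
  subst hk
  nlinarith

/-- A rotational surface in `H²×ℝ`, meeting its axis orthogonally and satisfying an
elliptic Weingarten equation `κ₁ = f(κ₂)` (with `f` self-inverse, decreasing, and with
the appropriate boundary behavior), has bounded second fundamental form. -/
theorem weingarten_bounded_second_fundamental_form
    (a b : EReal) (hab : a < b)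
    (I : Set ℝ) (hI : I = {x : ℝ | a < (x : EReal) ∧ (x : EReal) < b})
    (f : ℝ → ℝ) (hf : ContDiffOn ℝ (⊤ : ℕ∞) f I)
    (hf' : ∀ x ∈ I, deriv f x < 0)
    (hfI : f '' I = I) (hff : ∀ x ∈ I, f (f x) = x)
    (ha : a ≠ ⊥ → b = ⊤ ∧ Tendsto f (𝓝[>] a.toReal) atTop)
    (hb : b ≠ ⊤ → a = ⊥ ∧ Tendsto f (𝓝[<] b.toReal) atBot)
    (J : Set ℝ) (hJ : (∃ sStar : ℝ, 0 < sStar ∧ J = Set.Ico 0 sStar) ∨ J = Set.Ici 0)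
    (r h : ℝ → ℝ)
    (hr : ContDiffOn ℝ (⊤ : ℕ∞) r J) (hh : ContDiffOn ℝ (⊤ : ℕ∞) h J)
    (hunit : ∀ s ∈ J,
      (derivWithin r (Set.Ici 0) s) ^ 2 + (derivWithin h (Set.Ici 0) s) ^ 2 = 1)
    (hr0 : r 0 = 0) (hh0 : h 0 = 0)
    (hh'0 : derivWithin h (Set.Ici 0) 0 = 0) (hr'0 : derivWithin r (Set.Ici 0) 0 = 1)
    (hpos : ∀ s ∈ J \ {0}, 0 < r s ∧ 0 < derivWithin r (Set.Ici 0) s ∧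
      0 < derivWithin h (Set.Ici 0) s)
    (hmono : StrictAntiOn (derivWithin r (Set.Ici 0)) J)
    (κ₁ κ₂ : ℝ → ℝ)
    (hκ₁ : ∀ s, κ₁ s =
      derivWithin r (Set.Ici 0) s * derivWithin (derivWithin h (Set.Ici 0)) (Set.Ici 0) s
      - derivWithin (derivWithin r (Set.Ici 0)) (Set.Ici 0) s * derivWithin h (Set.Ici 0) s)
    (hκ₂ : ∀ s, κ₂ s = derivWithin h (Set.Ici 0) s * Real.cosh (r s) / Real.sinh (r s))
    (hWein : ∀ s ∈ J \ {0}, κ₂ s ∈ I ∧ κ₁ s = f (κ₂ s)) :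
    ∃ C : ℝ, ∀ s ∈ J \ {0}, (κ₁ s) ^ 2 + (κ₂ s) ^ 2 ≤ C := by
  set R := derivWithin r (Set.Ici 0) with hRdef
  set H := derivWithin h (Set.Ici 0) with hHdef
  set R2 := derivWithin R (Set.Ici 0) with hR2def
  set H2 := derivWithin H (Set.Ici 0) with hH2def
  have hRs : ContDiffOn ℝ (⊤ : ℕ∞) R J := contDiffOn_derivWithin_Ici hJ hr
  have hHs : ContDiffOn ℝ (⊤ : ℕ∞) H J := contDiffOn_derivWithin_Ici hJ hh
  have hR2s : ContDiffOn ℝ (⊤ : ℕ∞) R2 J := contDiffOn_derivWithin_Ici hJ hRs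
  have hH2s : ContDiffOn ℝ (⊤ : ℕ∞) H2 J := contDiffOn_derivWithin_Ici hJ hHs
  have hJnn : ∀ s ∈ J, 0 ≤ s := by
    rcases hJ with ⟨S, hS, rfl⟩ | rfl
    · exact fun s hs => hs.1
    · exact fun s hs => hs
  have hJpos : ∀ s ∈ J \ {0}, 0 < s := fun s hs =>
    lt_of_le_of_ne (hJnn s hs.1) (fun h => hs.2 h.symm)
  obtain ⟨s₀, hs₀⟩ : ∃ s₀, s₀ ∈ J \ {0} := by
    rcases hJ with ⟨S, hS, rfl⟩ | rfl
    · exact ⟨S / 2, ⟨by constructor <;> linarith, by simp [hS.ne']⟩⟩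
    · exact ⟨1, by simp⟩
  have hs₀pos := hJpos s₀ hs₀
  have hJord : J.OrdConnected := by
    rcases hJ with ⟨S, hS, rfl⟩ | rfl
    · exact ordConnected_Ico
    · exact ordConnected_Ici
  have h0J : (0 : ℝ) ∈ J := by
    rcases hJ with ⟨S, hS, rfl⟩ | rfl
    · exact ⟨le_rfl, hS⟩
    · exact self_mem_Ici
  have hsub : Icc 0 s₀ ⊆ J := hJord.out h0J hs₀.1
  have hr' : ∀ s ∈ J \ {0}, HasDerivAt r (R s) s := fun s hs =>
    hasDerivAt_derivWithin_Ici hJ hr hs.1 (hJpos s hs)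
  have hR' : ∀ s ∈ J \ {0}, HasDerivAt R (R2 s) s := fun s hs =>
    hasDerivAt_derivWithin_Ici hJ hRs hs.1 (hJpos s hs)
  have hH' : ∀ s ∈ J \ {0}, HasDerivAt H (H2 s) s := fun s hs =>
    hasDerivAt_derivWithin_Ici hJ hHs hs.1 (hJpos s hs)
  have horth : ∀ s ∈ J \ {0}, R s * R2 s + H s * H2 s = 0 := by
    intro s hs
    have h1 := ((hR' s hs).pow 2).add ((hH' s hs).pow 2)
    have h2 : HasDerivAt (R ^ 2 + H ^ 2) 0 s := by
      refine (hasDerivAt_const s (1 : ℝ)).congr_of_eventuallyEq ?_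
      filter_upwards [mem_nhds_of_pos hJ hs.1 (hJpos s hs)] with t ht
      exact hunit t ht
    have := h1.unique h2
    norm_num at this
    linarith
  have hk₁R : ∀ s ∈ J \ {0}, R s * κ₁ s = H2 s := by
    intro s hs
    rw [hκ₁]
    linear_combination H2 s * hunit s hs.1 - H s * horth s hs
  have hk₁H : ∀ s ∈ J \ {0}, H s * κ₁ s = -R2 s := by
    intro s hs
    rw [hκ₁]
    linear_combination (-R2 s) * hunit s hs.1 + R s * horth s hs
  have hR2nonpos : ∀ s ∈ J \ {0}, R2 s ≤ 0 := by
    intro s hs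
    have h1 : derivWithin R J s ≤ 0 := hmono.antitoneOn.derivWithin_nonpos
    rwa [derivWithin_of_mem_nhds (mem_nhds_of_pos hJ hs.1 (hJpos s hs)), (hR' s hs).deriv] at h1
  have hk₁nn : ∀ s ∈ J \ {0}, 0 ≤ κ₁ s := by
    intro s hs
    have h1 := hk₁H s hs
    have h2 := hR2nonpos s hs
    exact nonneg_of_mul_nonneg_right (by linarith) (hpos s hs).2.2
  have hk₂nn : ∀ s ∈ J \ {0}, 0 ≤ κ₂ s := by
    intro s hs
    obtain ⟨h1, -, h3⟩ := hpos s hs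
    have := Real.sinh_pos_iff.2 h1
    have := Real.cosh_pos (r s)
    rw [hκ₂]; positivity
  have hrmono : MonotoneOn r J := by
    refine monotoneOn_of_deriv_nonneg hJord.convex hr.continuousOn
      ((hr.differentiableOn (by simp)).mono interior_subset) ?_
    intro s hs
    have hspos : s ∈ interior (Ici (0 : ℝ)) := interior_mono hJnn hs
    rw [interior_Ici] at hspos
    have hs0 : s ∈ J \ {0} := ⟨interior_subset hs, (mem_Ioi.1 hspos).ne'⟩
    rw [(hr' s hs0).deriv]
    exact (hpos s hs0).2.1.le
  -- bounds near the axis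
  obtain ⟨K, hK⟩ : ∃ K, ∀ s ∈ Icc 0 s₀, ‖H2 s‖ ≤ K :=
    isCompact_Icc.exists_bound_of_continuousOn (hH2s.continuousOn.mono hsub)
  obtain ⟨K₁, hK₁⟩ : ∃ K₁, ∀ s ∈ Icc 0 s₀, ‖R s * H2 s - R2 s * H s‖ ≤ K₁ :=
    isCompact_Icc.exists_bound_of_continuousOn (((hRs.continuousOn.mul hH2s.continuousOn).sub
      (hR2s.continuousOn.mul hHs.continuousOn)).mono hsub)
  have hnear : ∀ s ∈ J \ {0}, s ≤ s₀ → κ₂ s ≤ K * Real.cosh (r s₀) / R s₀ := by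
    intro s hs hle
    have hspos := hJpos s hs
    have hsub' : Icc 0 s ⊆ J := hJord.out h0J hs.1
    have hmem : ∀ c ∈ Ioo 0 s, c ∈ J \ {0} := fun c hc =>
      ⟨hsub' (Ioo_subset_Icc_self hc), hc.1.ne'⟩
    obtain ⟨c, hc, hceq⟩ := exists_hasDerivAt_eq_slope r R hspos
      (hr.continuousOn.mono hsub') (fun c hc => hr' c (hmem c hc))
    obtain ⟨d, hd, hdeq⟩ := exists_hasDerivAt_eq_slope H H2 hspos
      (hHs.continuousOn.mono hsub') (fun c hc => hH' c (hmem c hc))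
    rw [hr0, sub_zero, sub_zero, eq_div_iff hspos.ne'] at hceq
    rw [hh'0, sub_zero, sub_zero, eq_div_iff hspos.ne'] at hdeq
    have hRc : R s₀ ≤ R c := hmono.antitoneOn (hmem c hc).1 hs₀.1 (hc.2.le.trans hle)
    have hHd : H2 d ≤ K := (le_abs_self _).trans (hK d ⟨hd.1.le, hd.2.le.trans hle⟩)
    have hR₀ := (hpos s₀ hs₀).2.1
    have hsh : R s₀ * s ≤ Real.sinh (r s) := by
      have h1 : r s ≤ Real.sinh (r s) := Real.self_le_sinh_iff.2 (hpos s hs).1.le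
      nlinarith
    have hch : Real.cosh (r s) ≤ Real.cosh (r s₀) := by
      rw [Real.cosh_le_cosh, abs_of_pos (hpos s hs).1, abs_of_pos (hpos s₀ hs₀).1]
      exact hrmono hs.1 hs₀.1 hle
    have hHK : H s ≤ K * s := by nlinarith
    have hHpos := (hpos s hs).2.2
    rw [hκ₂]
    calc H s * Real.cosh (r s) / Real.sinh (r s)
        ≤ (K * s) * Real.cosh (r s₀) / (R s₀ * s) := by
          have := Real.cosh_pos (r s)
          have := Real.cosh_pos (r s₀)
          have : 0 ≤ K * s := hHpos.le.trans hHK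
          gcongr
      _ = K * Real.cosh (r s₀) / R s₀ := by field_simp
  -- bounds away from the axis
  have hfar₂ : ∀ s ∈ J \ {0}, s₀ ≤ s → κ₂ s ≤ 1 + 1 / Real.sinh (r s₀) := by
    intro s hs hle
    have hrle := hrmono hs₀.1 hs.1 hle
    have hsh₀ : 0 < Real.sinh (r s₀) := Real.sinh_pos_iff.2 (hpos s₀ hs₀).1
    have hshle : Real.sinh (r s₀) ≤ Real.sinh (r s) := Real.sinh_le_sinh.2 hrle
    have hsh : 0 < Real.sinh (r s) := hsh₀.trans_le hshle
    have hH1 : H s ≤ 1 := by nlinarith [hunit s hs.1, sq_nonneg (R s), sq_nonneg (H s - 1)]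
    have hch : Real.cosh (r s) ≤ Real.sinh (r s) + 1 := by
      nlinarith [Real.cosh_sq (r s), Real.cosh_pos (r s)]
    rw [hκ₂]
    calc H s * Real.cosh (r s) / Real.sinh (r s)
        ≤ 1 * (Real.sinh (r s) + 1) / Real.sinh (r s) := by
          have := Real.cosh_pos (r s)
          gcongr
      _ = 1 + 1 / Real.sinh (r s) := by field_simp
      _ ≤ 1 + 1 / Real.sinh (r s₀) := by gcongr
  have hIord : I.OrdConnected := by
    subst hI
    exact ⟨fun x hx y hy z hz => ⟨hx.1.trans_le (EReal.coe_le_coe_iff.2 hz.1),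
      (EReal.coe_le_coe_iff.2 hz.2).trans_lt hy.2⟩⟩
  have hfanti : AntitoneOn f I :=
    antitoneOn_of_deriv_nonpos hIord.convex hf.continuousOn
      ((hf.differentiableOn (by simp)).mono interior_subset)
      (fun x hx => (hf' x (interior_subset hx)).le)
  obtain ⟨m, hmI, hmle, hmf⟩ : ∃ m ∈ I, m ≤ κ₂ s₀ ∧ m ≤ f m := by
    have hx := (hWein s₀ hs₀).1
    rcases le_total (κ₂ s₀) (f (κ₂ s₀)) with hle | hle
    · exact ⟨_, hx, le_rfl, hle⟩
    · exact ⟨f (κ₂ s₀), hfI ▸ mem_image_of_mem f hx, hle, by rwa [hff _ hx]⟩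
  have hfar₁ : ∀ s ∈ J \ {0}, s₀ ≤ s → κ₁ s ≤ f m := by
    intro s hs hle
    rw [(hWein s hs).2]
    refine hfanti hmI (hWein s hs).1 ?_
    have hmem : ∀ t ∈ Icc s₀ s, t ∈ J \ {0} := fun t ht =>
      ⟨hJord.out hs₀.1 hs.1 ht, (hs₀pos.trans_le ht.1).ne'⟩
    refine le_of_hasDerivAt_pos_at_level hle (fun t ht => ?_) hmle (fun t ht heq => ?_)
      (k' := fun t => ((H2 t * Real.cosh (r t) + H t * (Real.sinh (r t) * R t)) * Real.sinh (r t)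
        - H t * Real.cosh (r t) * (Real.cosh (r t) * R t)) / Real.sinh (r t) ^ 2)
    · rw [funext hκ₂]
      have htJ := hmem t ht
      exact ((hH' t htJ).mul (hr' t htJ).cosh).div (hr' t htJ).sinh
        (Real.sinh_pos_iff.2 (hpos t htJ).1).ne'
    · have htJ := hmem t ht
      obtain ⟨h1, h2, h3⟩ := hpos t htJ
      refine coth_curvature_deriv_pos h1 h2 h3 (hk₁R t htJ) ?_
      rw [← hκ₂, (hWein t htJ).2, heq]
      exact hmf
  refine ⟨(max K₁ (f m)) ^ 2
    + (max (K * Real.cosh (r s₀) / R s₀) (1 + 1 / Real.sinh (r s₀))) ^ 2, fun s hs => ?_⟩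
  refine add_le_add (pow_le_pow_left₀ (hk₁nn s hs) ?_ 2) (pow_le_pow_left₀ (hk₂nn s hs) ?_ 2)
  · rcases le_total s s₀ with hle | hle
    · refine le_max_of_le_left ?_
      rw [hκ₁]
      exact (le_abs_self _).trans (hK₁ s ⟨hJnn s hs.1, hle⟩)
    · exact le_max_of_le_right (hfar₁ s hs hle)
  · rcases le_total s s₀ with hle | hle
    · exact le_max_of_le_left (hnear s hs hle)
    · exact le_max_of_le_right (hfar₂ s hs hle)
end

section
/- Let W : ℝ² → ℝ be C^∞, symmetric (W(k₁,k₂) = W(k₂,k₁) for all k₁,k₂), and satisfying the ellipticity condition (∂W/∂k₁)(∂W/∂k₂) > 0 at every point of W⁻¹(0). Let Γ be a nonempty connected component of W⁻¹(0) that is invariant under the reflection (k₁,k₂) ↦ (k₂,k₁). Then there exist an open interval I = (a,b) with −∞ ≤ a < b ≤ +∞ and a C^∞ function f : I → ℝ such that: (i) f'(x) < 0 for all x ∈ I; (ii) f(I) = I and f(f(x)) = x for all x ∈ I; (iii) Γ = {(f(x), x) : x ∈ I}; (iv) if a > −∞ then b = +∞ and f(x) → +∞ as x → a⁺; (v) if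 b < +∞ then a = −∞ and f(x) → −∞ as x → b⁻; and (vi) there is a unique α ∈ I with f(α) = α (the umbilicity constant). -/
open Set Filter Topology

/-- Near each of its points, `Z` is the graph, over an open preconnected set `V`, of a continuous
function of the first coordinate. -/
def IsLocalGraph (Z : Set (ℝ × ℝ)) : Prop :=
  ∀ q ∈ Z, ∃ (φ : ℝ → ℝ) (V U : Set ℝ), IsOpen V ∧ IsPreconnected V ∧ IsOpen U ∧ q.1 ∈ V ∧
    q.2 ∈ U ∧ ContinuousOn φ V ∧ MapsTo φ V U ∧ ∀ x ∈ V, ∀ y ∈ U, (x, y) ∈ Z ↔ φ x = y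

/-- Two points of `Z` lie on the graph of a continuous function which is contained in `Z`. -/
def JoinedByGraph (Z : Set (ℝ × ℝ)) (q r : ℝ × ℝ) : Prop :=
  ∃ (J : Set ℝ) (g : ℝ → ℝ), IsOpen J ∧ IsPreconnected J ∧ ContinuousOn g J ∧
    (∀ x ∈ J, (x, g x) ∈ Z) ∧ q.1 ∈ J ∧ r.1 ∈ J ∧ g q.1 = q.2 ∧ g r.1 = r.2

theorem JoinedByGraph.symm {Z : Set (ℝ × ℝ)} {q r : ℝ × ℝ} (h : JoinedByGraph Z q r) :
    JoinedByGraph Z r q := by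
  obtain ⟨J, g, h1, h2, h3, h4, h5, h6, h7, h8⟩ := h
  exact ⟨J, g, h1, h2, h3, h4, h6, h5, h8, h7⟩

/-- Continuous functions whose graphs lie in a local graph agree as soon as they agree at a
point. -/
theorem IsLocalGraph.eqOn {Z : Set (ℝ × ℝ)} (hZ : IsLocalGraph Z) {J : Set ℝ}
    (hJ : IsPreconnected J) {g₁ g₂ : ℝ → ℝ} (h₁ : ContinuousOn g₁ J) (h₂ : ContinuousOn g₂ J)
    (hg₁ : ∀ x ∈ J, (x, g₁ x) ∈ Z) (hg₂ : ∀ x ∈ J, (x, g₂ x) ∈ Z) {a : ℝ} (ha : a ∈ J)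
    (hag : g₁ a = g₂ a) : EqOn g₁ g₂ J := by
  have inj : IsLocallyInjective (fun z : Z => z.1.1) := by
    intro z
    obtain ⟨φ, V, U, hV, -, hU, hzV, hzU, -, -, hiff⟩ := hZ z.1 z.2
    refine ⟨Subtype.val ⁻¹' (V ×ˢ U), (hV.prod hU).preimage continuous_subtype_val,
      ⟨hzV, hzU⟩, ?_⟩
    rintro ⟨⟨x, y⟩, hxy⟩ hm ⟨⟨x', y'⟩, hxy'⟩ hm' (rfl : x = x')
    have e := (hiff x hm.1 y hm.2).1 hxy
    have e' := (hiff x hm'.1 y' hm'.2).1 hxy'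
    exact Subtype.ext (Prod.ext rfl (e.symm.trans e'))
  have := isPreconnected_iff_preconnectedSpace.1 hJ
  have key := T2Space.isSeparatedMap (fun z : Z => z.1.1) |>.eq_of_comp_eq inj
    (g₁ := fun x : J => ⟨(x.1, g₁ x.1), hg₁ x.1 x.2⟩)
    (g₂ := fun x : J => ⟨(x.1, g₂ x.1), hg₂ x.1 x.2⟩)
    ((continuous_subtype_val.prodMk h₁.domRestrict).subtype_mk _)
    ((continuous_subtype_val.prodMk h₂.domRestrict).subtype_mk _) rfl ⟨a, ha⟩
    (by simp [hag])
  intro x hx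
  have := congrFun key ⟨x, hx⟩
  simpa using this

theorem IsLocalGraph.joinedByGraph_trans {Z : Set (ℝ × ℝ)} (hZ : IsLocalGraph Z)
    {q r s : ℝ × ℝ} (hqr : JoinedByGraph Z q r) (hrs : JoinedByGraph Z r s) :
    JoinedByGraph Z q s := by
  classical
  obtain ⟨J, g, oJ, cJ, cg, gZ, qJ, rJ, gq, gr⟩ := hqr
  obtain ⟨K, k, oK, cK, ck, kZ, rK, sK, kr, ks⟩ := hrs
  have hJK : IsPreconnected (J ∩ K) := (cJ.ordConnected.inter cK.ordConnected).isPreconnected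
  have heq : EqOn g k (J ∩ K) :=
    hZ.eqOn hJK (cg.mono inter_subset_left) (ck.mono inter_subset_right)
      (fun x hx => gZ x hx.1) (fun x hx => kZ x hx.2) ⟨rJ, rK⟩ (gr.trans kr.symm)
  have hg : EqOn (J.piecewise g k) g J := fun x hx => by simp [hx]
  have hk : EqOn (J.piecewise g k) k K := fun x hx => by
    by_cases h : x ∈ J
    · simpa [h] using heq ⟨h, hx⟩
    · simp [h]
  refine ⟨J ∪ K, J.piecewise g k, oJ.union oK, cJ.union r.1 rJ rK cK,
    (cg.congr hg).union_of_isOpen (ck.congr hk) oJ oK, ?_, .inl qJ, .inr sK,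
    (hg qJ).trans gq, (hk sK).trans ks⟩
  rintro x (hx | hx)
  · rw [hg hx]; exact gZ x hx
  · rw [hk hx]; exact kZ x hx

theorem IsLocalGraph.injOn_fst {Z C : Set (ℝ × ℝ)} (hZ : IsLocalGraph Z)
    (hC : IsPreconnected C) (hCZ : C ⊆ Z) : InjOn Prod.fst C := by
  intro q hq r hr hqr
  have : JoinedByGraph Z q r := by
    refine hC.induction₂ (JoinedByGraph Z) ?_ (fun x y z _ _ _ => hZ.joinedByGraph_trans)
      (fun x y _ _ => JoinedByGraph.symm) hq hr
    intro x hx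
    obtain ⟨φ, V, U, oV, cV, oU, hxV, hxU, cφ, hφ, hiff⟩ := hZ x (hCZ hx)
    filter_upwards [self_mem_nhdsWithin,
      mem_nhdsWithin_of_mem_nhds ((oV.prod oU).mem_nhds ⟨hxV, hxU⟩)] with y hy hyVU
    exact ⟨V, φ, oV, cV, cφ, fun z hz => (hiff z hz _ (hφ hz)).2 rfl, hxV, hyVU.1,
      (hiff _ hxV _ hxU).1 (hCZ hx), (hiff _ hyVU.1 _ hyVU.2).1 (hCZ hy)⟩
  obtain ⟨J, g, -, -, -, -, -, -, h1, h2⟩ := this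
  exact Prod.ext hqr (by rw [← h1, ← h2, hqr])

/-- The implicit function theorem for a scalar equation in the plane, with an explicit
neighbourhood on which the zero set is a graph. -/
theorem exists_implicit_graph {W : ℝ × ℝ → ℝ} (hW : ContDiff ℝ (⊤ : ℕ∞) W) {q : ℝ × ℝ}
    (hq : W q = 0) (hd : fderiv ℝ W q (0, 1) ≠ 0) :
    ∃ (φ : ℝ → ℝ) (V U : Set ℝ), ContDiffAt ℝ (⊤ : ℕ∞) φ q.1 ∧ IsOpen V ∧ IsPreconnected V ∧
      IsOpen U ∧ q.1 ∈ V ∧ q.2 ∈ U ∧ ContinuousOn φ V ∧ MapsTo φ V U ∧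
      ∀ x ∈ V, ∀ y ∈ U, (x, y) ∈ W ⁻¹' {0} ↔ φ x = y := by
  have hc : ContDiffAt ℝ (⊤ : ℕ∞) W q := hW.contDiffAt
  have hn : ((⊤ : ℕ∞) : WithTop ℕ∞) ≠ 0 := by simp
  have hinv : (fderiv ℝ W q ∘L .inr ℝ ℝ ℝ).IsInvertible := by
    refine ⟨ContinuousLinearEquiv.unitsEquivAut ℝ (Units.mk0 _ hd), ?_⟩
    ext
    simp
  set φ := hc.implicitFunction hn hinv
  have hφ : ContDiffAt ℝ (⊤ : ℕ∞) φ q.1 := hc.contDiffAt_implicitFunction hn hinv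
  have hφq : φ q.1 = q.2 := hc.implicitFunction_apply_self hn hinv
  have hev := hc.eventually_apply_eq_iff_implicitFunction hn hinv
  rw [hq, nhds_prod_eq] at hev
  obtain ⟨S, hS, T, hT, hST⟩ := mem_prod_iff.1 hev
  obtain ⟨U, hUT, oU, hqU⟩ := mem_nhds_iff.1 hT
  have hcont : ∀ᶠ x in 𝓝 q.1, ContinuousAt φ x :=
    ((hφ.of_le (m := 1) (by exact_mod_cast le_top)).eventually (by simp)).mono
      fun x hx => hx.continuousAt
  have hmaps : ∀ᶠ x in 𝓝 q.1, φ x ∈ U :=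
    hφ.continuousAt.eventually_mem (by rw [hφq]; exact oU.mem_nhds hqU)
  obtain ⟨ε, hε, hball⟩ := Metric.mem_nhds_iff.1 (inter_mem hS (inter_mem hcont hmaps))
  refine ⟨φ, Metric.ball q.1 ε, U, hφ, Metric.isOpen_ball, (convex_ball _ _).isPreconnected, oU,
    Metric.mem_ball_self hε, hqU, fun x hx => (hball hx).2.1.continuousWithinAt,
    fun x hx => (hball hx).2.2, fun x hx y hy => ?_⟩
  exact hST (mk_mem_prod (hball hx).1 (hUT hy))

/-- An open preconnected subset of `ℝ` is an open interval with extended real endpoints. -/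
theorem IsOpen.exists_eq_ereal_interval {I : Set ℝ} (ho : IsOpen I) (hc : IsPreconnected I) :
    ∃ a b : EReal, I = {x : ℝ | a < (x : EReal) ∧ (x : EReal) < b} := by
  refine ⟨sInf ((↑) '' I), sSup ((↑) '' I), Subset.antisymm ?_ ?_⟩
  · intro x hx
    obtain ⟨ε, hε, hball⟩ := Metric.isOpen_iff.1 ho x hx
    have h1 : x - ε / 2 ∈ I := hball (by simp [abs_of_pos, hε])
    have h2 : x + ε / 2 ∈ I := hball (by simp [abs_of_pos, hε])
    exact ⟨(sInf_le (mem_image_of_mem _ h1)).trans_lt (EReal.coe_lt_coe_iff.2 (by linarith)),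
      (EReal.coe_lt_coe_iff.2 (by linarith)).trans_le (le_sSup (mem_image_of_mem _ h2))⟩
  · rintro x ⟨h1, h2⟩
    obtain ⟨_, ⟨y, hy, rfl⟩, hyx⟩ := sInf_lt_iff.1 h1
    obtain ⟨_, ⟨z, hz, rfl⟩, hxz⟩ := lt_sSup_iff.1 h2
    exact hc.ordConnected.out hy hz
      ⟨(EReal.coe_lt_coe_iff.1 hyx).le, (EReal.coe_lt_coe_iff.1 hxz).le⟩

theorem IsClosed.connectedComponentIn {X : Type*} [TopologicalSpace X] {F : Set X}
    (hF : IsClosed F) (x : X) : IsClosed (connectedComponentIn F x) := by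
  by_cases hx : x ∈ F
  · refine isClosed_of_closure_subset ?_
    exact isPreconnected_connectedComponentIn.closure.subset_connectedComponentIn
      (subset_closure (mem_connectedComponentIn hx))
      (closure_minimal (connectedComponentIn_subset F x) hF)
  · simp [connectedComponentIn_eq_empty hx]

/-- An implicit function has negative slope where the partial derivatives have the same sign. -/
theorem deriv_implicit_neg {W : ℝ × ℝ → ℝ} {f : ℝ → ℝ} {x : ℝ}
    (hW : DifferentiableAt ℝ W (x, f x)) (hf : DifferentiableAt ℝ f x)
    (h0 : ∀ᶠ y in 𝓝 x, W (y, f y) = 0)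
    (hpos : 0 < fderiv ℝ W (x, f x) (1, 0) * fderiv ℝ W (x, f x) (0, 1)) : deriv f x < 0 := by
  have h1 : HasDerivAt (fun y => W (y, f y)) (fderiv ℝ W (x, f x) (1, deriv f x)) x :=
    hW.hasFDerivAt.comp_hasDerivAt x ((hasDerivAt_id x).prodMk hf.hasDerivAt)
  have h2 : HasDerivAt (fun y => W (y, f y)) 0 x :=
    (hasDerivAt_const x (0 : ℝ)).congr_of_eventuallyEq h0
  have h3 := h1.unique h2
  have h4 : ((1 : ℝ), deriv f x) = (1, 0) + deriv f x • ((0 : ℝ), (1 : ℝ)) := by simp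
  rw [h4, map_add, map_smul, smul_eq_mul] at h3
  by_contra hneg
  push Not at hneg
  rw [eq_neg_of_add_eq_zero_left h3] at hpos
  nlinarith [mul_nonneg hneg (sq_nonneg (fderiv ℝ W (x, f x) (0, 1)))]

theorem deriv_prodMk_left {W : ℝ × ℝ → ℝ} {p : ℝ × ℝ} (hW : DifferentiableAt ℝ W p) :
    deriv (fun x => W (x, p.2)) p.1 = fderiv ℝ W p (1, 0) :=
  (hW.hasFDerivAt.comp_hasDerivAt p.1
    ((hasDerivAt_id p.1).prodMk (hasDerivAt_const p.1 p.2))).deriv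

theorem deriv_prodMk_right {W : ℝ × ℝ → ℝ} {p : ℝ × ℝ} (hW : DifferentiableAt ℝ W p) :
    deriv (fun y => W (p.1, y)) p.2 = fderiv ℝ W p (0, 1) :=
  (hW.hasFDerivAt.comp_hasDerivAt p.2
    ((hasDerivAt_const p.2 p.1).prodMk (hasDerivAt_id p.2))).deriv

/-- A nonempty preconnected set of reals with a strictly decreasing continuous involution contains
exactly one fixed point. -/
theorem existsUnique_fixedPoint_of_strictAntiOn {I : Set ℝ} {f : ℝ → ℝ} (hc : IsPreconnected I)
    (hne : I.Nonempty) (hf : ContinuousOn f I) (hanti : StrictAntiOn f I) (hmaps : MapsTo f I I)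
    (hinv : ∀ x ∈ I, f (f x) = x) : ∃! α : ℝ, α ∈ I ∧ f α = α := by
  obtain ⟨x, hx⟩ := hne
  have hex : ∃ α ∈ I, f α = α := by
    rcases le_total (f x) x with h | h
    · exact hc.intermediate_value₂ hx (hmaps hx) hf continuousOn_id h (by rw [hinv x hx]; exact h)
    · exact hc.intermediate_value₂ (hmaps hx) hx hf continuousOn_id (by rw [hinv x hx]; exact h) h
  obtain ⟨α, hα, hfα⟩ := hex
  refine ⟨α, ⟨hα, hfα⟩, fun β hβ => ?_⟩
  rcases lt_trichotomy β α with h | h | h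
  · have := hanti hβ.1 hα h
    rw [hβ.2, hfα] at this
    exact absurd this h.not_gt
  · exact h
  · have := hanti hα hβ.1 h
    rw [hβ.2, hfα] at this
    exact absurd this h.not_gt

/-- A symmetric connected component `Γ` of the zero set of an elliptic Weingarten
functional `W` is the graph `k₁ = f(k₂)` of a smooth strictly decreasing involution `f`
of an interval `I = (a,b)`, with the appropriate boundary behavior, and `f` has a unique
fixed point (the umbilicity constant). -/
theorem weingarten_component_involution
    (W : ℝ × ℝ → ℝ) (hW : ContDiff ℝ (⊤ : ℕ∞) W)
    (hsym : ∀ k₁ k₂ : ℝ, W (k₁, k₂) = W (k₂, k₁))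
    (hell : ∀ p : ℝ × ℝ, W p = 0 →
      0 < deriv (fun x => W (x, p.2)) p.1 * deriv (fun y => W (p.1, y)) p.2)
    (Γ : Set (ℝ × ℝ)) (p : ℝ × ℝ) (hp : W p = 0)
    (hΓ : Γ = connectedComponentIn (W ⁻¹' {0}) p)
    (hΓsym : ∀ q : ℝ × ℝ, q ∈ Γ → (q.2, q.1) ∈ Γ) :
    ∃ (a b : EReal) (f : ℝ → ℝ), a < b ∧
      (∀ I : Set ℝ, I = {x : ℝ | a < (x : EReal) ∧ (x : EReal) < b} →
        ContDiffOn ℝ (⊤ : ℕ∞) f I ∧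
        (∀ x ∈ I, deriv f x < 0) ∧
        f '' I = I ∧ (∀ x ∈ I, f (f x) = x) ∧
        Γ = (fun x => (f x, x)) '' I ∧
        (a ≠ ⊥ → b = ⊤ ∧ Tendsto f (𝓝[>] a.toReal) atTop) ∧
        (b ≠ ⊤ → a = ⊥ ∧ Tendsto f (𝓝[<] b.toReal) atBot) ∧
        (∃! α : ℝ, α ∈ I ∧ f α = α)) := by
  have hdiff : Differentiable ℝ W := hW.differentiable (by simp)
  have hpos : ∀ q : ℝ × ℝ, W q = 0 → 0 < fderiv ℝ W q (1, 0) * fderiv ℝ W q (0, 1) := by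
    intro q hq
    rw [← deriv_prodMk_left (hdiff q), ← deriv_prodMk_right (hdiff q)]
    exact hell q hq
  have himp := fun (q : ℝ × ℝ) (hq : W q = 0) =>
    exists_implicit_graph hW hq (right_ne_zero_of_mul (hpos q hq).ne')
  have hZ : IsLocalGraph (W ⁻¹' {0}) := by
    intro q hq
    obtain ⟨φ, V, U, -, h⟩ := himp q hq
    exact ⟨φ, V, U, h⟩
  have hΓZ : Γ ⊆ W ⁻¹' {0} := hΓ ▸ connectedComponentIn_subset _ _
  have hΓc : IsPreconnected Γ := hΓ ▸ isPreconnected_connectedComponentIn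
  have hΓclosed : IsClosed Γ :=
    hΓ ▸ (isClosed_singleton.preimage hW.continuous).connectedComponentIn p
  have hpΓ : p ∈ Γ := hΓ ▸ mem_connectedComponentIn hp
  have hinj : InjOn Prod.fst Γ := hZ.injOn_fst hΓc hΓZ
  -- Near each of its points, `Γ` contains the graph of a smooth function.
  have hloc : ∀ q ∈ Γ, ∃ φ : ℝ → ℝ, ContDiffAt ℝ (⊤ : ℕ∞) φ q.1 ∧
      ∀ᶠ x in 𝓝 q.1, (x, φ x) ∈ Γ := by
    intro q hq
    obtain ⟨φ, V, U, hφ, oV, cV, oU, hqV, hqU, cφ, mφ, hiff⟩ := himp q (hΓZ hq)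
    refine ⟨φ, hφ, ?_⟩
    filter_upwards [oV.mem_nhds hqV] with x hx
    have hgraph : IsPreconnected ((fun x => (x, φ x)) '' V) :=
      cV.image _ (continuousOn_id.prodMk cφ)
    have hqg : q ∈ (fun x => (x, φ x)) '' V :=
      ⟨q.1, hqV, Prod.ext rfl ((hiff _ hqV _ hqU).1 (hΓZ hq))⟩
    have hsub := hgraph.subset_connectedComponentIn hqg (F := W ⁻¹' {0}) (by
      rintro _ ⟨y, hy, rfl⟩
      exact (hiff y hy _ (mφ hy)).2 rfl)
    rw [hΓ] at hq
    rw [hΓ, connectedComponentIn_eq hq]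
    exact hsub (mem_image_of_mem _ hx)
  set I : Set ℝ := Prod.fst '' Γ
  have hex : ∀ x : ℝ, ∃ y : ℝ, x ∈ I → (x, y) ∈ Γ := by
    intro x
    by_cases hx : x ∈ I
    · obtain ⟨⟨x, y⟩, hq, rfl⟩ := hx
      exact ⟨y, fun _ => hq⟩
    · exact ⟨0, fun h => absurd h hx⟩
  choose f hf using hex
  have hfeq : ∀ x y : ℝ, (x, y) ∈ Γ → f x = y := fun x y h =>
    congrArg Prod.snd (hinj (hf x ⟨_, h, rfl⟩) h rfl)
  have oI : IsOpen I := by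
    rw [isOpen_iff_mem_nhds]
    rintro _ ⟨q, hq, rfl⟩
    obtain ⟨φ, -, h⟩ := hloc q hq
    filter_upwards [h] with x hx using ⟨_, hx, rfl⟩
  have cI : IsPreconnected I := hΓc.image _ continuous_fst.continuousOn
  have hsmooth : ∀ x ∈ I, ContDiffAt ℝ (⊤ : ℕ∞) f x := by
    intro x hx
    obtain ⟨φ, hφ, h⟩ := hloc _ (hf x hx)
    exact hφ.congr_of_eventuallyEq (h.mono fun y hy => hfeq _ _ hy)
  have hneg : ∀ x ∈ I, deriv f x < 0 := fun x hx =>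
    deriv_implicit_neg (hdiff _) ((hsmooth x hx).differentiableAt (by simp))
      ((oI.mem_nhds hx |> eventually_mem_set.2).mono fun y hy => hΓZ (hf y hy))
      (hpos _ (hΓZ (hf x hx)))
  have hcont : ContinuousOn f I := fun x hx => (hsmooth x hx).continuousAt.continuousWithinAt
  have hanti : StrictAntiOn f I :=
    strictAntiOn_of_deriv_neg cI.ordConnected.convex hcont
      fun x hx => hneg x (interior_subset hx)
  have hmaps : MapsTo f I I := fun x hx => ⟨_, hΓsym _ (hf x hx), rfl⟩
  have hinv : ∀ x ∈ I, f (f x) = x := fun x hx => hfeq _ _ (hΓsym _ (hf x hx))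
  have hpI : p.1 ∈ I := mem_image_of_mem _ hpΓ
  have hunb : ¬ ∃ c d : ℝ, I ⊆ Icc c d := by
    rintro ⟨c, d, hcd⟩
    have hΓK : IsCompact Γ :=
      (isCompact_Icc.prod isCompact_Icc).of_isClosed_subset hΓclosed
        (fun q hq => ⟨hcd ⟨q, hq, rfl⟩, hcd ⟨_, hΓsym q hq, rfl⟩⟩ : Γ ⊆ Icc c d ×ˢ Icc c d)
    have hIK : IsCompact I := hΓK.image continuous_fst
    have huniv : I = univ := IsClopen.eq_univ ⟨hIK.isClosed, oI⟩ ⟨_, hpI⟩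
    exact noncompact_univ ℝ (huniv ▸ hIK)
  obtain ⟨a, b, hab⟩ := oI.exists_eq_ereal_interval cI
  have hpab : a < (p.1 : EReal) ∧ (p.1 : EReal) < b := by
    have := hpI
    rwa [hab] at this
  have hends : a ≠ ⊥ → b ≠ ⊤ → False := by
    intro ha hb
    lift a to ℝ using ⟨hpab.1.ne_top, ha⟩
    lift b to ℝ using ⟨hb, hpab.2.ne_bot⟩
    refine hunb ⟨a, b, fun x hx => ?_⟩
    rw [hab] at hx
    exact ⟨(EReal.coe_lt_coe_iff.1 hx.1).le, (EReal.coe_lt_coe_iff.1 hx.2).le⟩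
  refine ⟨a, b, f, hpab.1.trans hpab.2, ?_⟩
  rintro _ rfl
  rw [← hab]
  refine ⟨fun x hx => (hsmooth x hx).contDiffWithinAt, hneg,
    Subset.antisymm hmaps.image_subset fun x hx => ⟨f x, hmaps hx, hinv x hx⟩, hinv, ?_, ?_, ?_,
    existsUnique_fixedPoint_of_strictAntiOn cI ⟨_, hpI⟩ hcont hanti hmaps hinv⟩
  · ext ⟨u, v⟩
    constructor
    · intro h
      exact ⟨v, ⟨_, hΓsym _ h, rfl⟩, Prod.ext (hfeq _ _ (hΓsym _ h)) rfl⟩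
    · rintro ⟨x, hx, h⟩
      rw [← h]
      exact hΓsym _ (hf x hx)
  · intro ha
    have hb : b = ⊤ := by_contra (hends ha)
    refine ⟨hb, tendsto_atTop.2 fun M => ?_⟩
    subst hb
    lift a to ℝ using ⟨hpab.1.ne_top, ha⟩
    have hmem : ∀ x : ℝ, x ∈ I ↔ a < x := by simp [hab]
    have hz : max M p.1 ∈ I := (hmem _).2 (lt_max_of_lt_right ((hmem _).1 hpI))
    filter_upwards [Ioo_mem_nhdsGT ((hmem _).1 (hmaps hz))] with y hy
    have := hanti ((hmem y).2 hy.1) (hmaps hz) hy.2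
    rw [hinv _ hz] at this
    exact (le_max_left _ _).trans this.le
  · intro hb
    have ha : a = ⊥ := by_contra fun ha => hends ha hb
    refine ⟨ha, tendsto_atBot.2 fun M => ?_⟩
    subst ha
    lift b to ℝ using ⟨hb, hpab.2.ne_bot⟩
    have hmem : ∀ x : ℝ, x ∈ I ↔ x < b := by simp [hab]
    have hz : min M p.1 ∈ I := (hmem _).2 (min_lt_of_right_lt ((hmem _).1 hpI))
    filter_upwards [Ioo_mem_nhdsLT ((hmem _).1 (hmaps hz))] with y hy
    have := hanti (hmaps hz) ((hmem y).2 hy.2) hy.1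
    rw [hinv _ hz] at this
    exact this.le.trans (min_le_left _ _)
end

section
/- Fix real numbers κ, τ, c with κ ≠ 4τ² and c > 0, and let δ be as in the context. Then there exists x₀ > 0 such that the interval [0,x₀] is contained in the domain of δ (i.e. 4+κx² > 0 and 4−(κ−8τ²)x² > 0 for all x ∈ [0,x₀]), δ is strictly decreasing on [0,x₀], δ(0) = 1, δ(x) > 0 for x ∈ [0,x₀), and δ(x₀) = 0. -/
open Set Filter Topology

/-- The square of the angle function along the rotational surface of constant extrinsic
curvature `c` in `E³(κ,τ)`:
`δ(x) = 1 + (2(c+τ²)/(κ−4τ²))·log((4−(κ−8τ²)x²)/(4+κx²))`. -/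
noncomputable def deltaFn (κ τ c x : ℝ) : ℝ :=
  1 + (2 * (c + τ ^ 2) / (κ - 4 * τ ^ 2)) *
    Real.log ((4 - (κ - 8 * τ ^ 2) * x ^ 2) / (4 + κ * x ^ 2))

theorem monotone_mul_one_add_exp_neg_sub :
    Monotone fun y : ℝ => y * (1 + Real.exp (-y)) - 2 * (1 - Real.exp (-y)) := by
  have hderiv : ∀ y : ℝ, HasDerivAt
      (fun y : ℝ => y * (1 + Real.exp (-y)) - 2 * (1 - Real.exp (-y)))
      (1 - Real.exp (-y) * (y + 1)) y := by
    intro y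
    have hexp : HasDerivAt (fun y : ℝ => Real.exp (-y)) (-Real.exp (-y)) y := by
      simpa using (hasDerivAt_neg y).exp
    refine (((hasDerivAt_id y).mul (hexp.const_add 1)).sub
      ((hexp.const_sub 1).const_mul 2)).congr_deriv ?_
    simp only [id]
    ring
  refine monotone_of_deriv_nonneg (fun y => (hderiv y).differentiableAt) fun y => ?_
  rw [(hderiv y).deriv, sub_nonneg]
  calc Real.exp (-y) * (y + 1) ≤ Real.exp (-y) * Real.exp y := by
        gcongr
        exact Real.add_one_le_exp y
    _ = 1 := by rw [← Real.exp_add, neg_add_cancel, Real.exp_zero]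

/-- A form of the inequality `tanh (y / 2) / (y / 2) ≤ 1`. -/
theorem one_sub_exp_neg_div_le {y : ℝ} (hy : y ≠ 0) :
    2 * ((1 - Real.exp (-y)) / y) ≤ 1 + Real.exp (-y) := by
  have hmono := monotone_mul_one_add_exp_neg_sub
  rcases lt_or_gt_of_ne hy with h | h
  · have := hmono h.le
    simp only [neg_zero, Real.exp_zero] at this
    rw [mul_div_assoc', div_le_iff_of_neg h]
    linarith
  · have := hmono h.le
    simp only [neg_zero, Real.exp_zero] at this
    rw [mul_div_assoc', div_le_iff₀ h]
    linarith

theorem one_sub_exp_neg_div_pos {y : ℝ} (hy : y ≠ 0) :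
    0 < (1 - Real.exp (-y)) / y := by
  rcases lt_or_gt_of_ne hy with h | h
  · refine div_pos_of_neg_of_neg ?_ h
    rw [sub_neg, Real.one_lt_exp_iff]
    linarith
  · refine div_pos ?_ h
    rw [sub_pos, Real.exp_lt_one_iff]
    linarith

theorem deltaFn_zero (κ τ c : ℝ) : deltaFn κ τ c 0 = 1 := by
  simp [deltaFn]

theorem deltaFn_lt_deltaFn {κ τ c x y : ℝ} (hκτ : κ ≠ 4 * τ ^ 2) (hc : 0 < c)
    (hx : 0 ≤ x) (hxy : x < y)
    (hdx : 0 < 4 + κ * x ^ 2) (hnx : 0 < 4 - (κ - 8 * τ ^ 2) * x ^ 2)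
    (hdy : 0 < 4 + κ * y ^ 2) (hny : 0 < 4 - (κ - 8 * τ ^ 2) * y ^ 2) :
    deltaFn κ τ c y < deltaFn κ τ c x := by
  have hsq : 0 < y ^ 2 - x ^ 2 := by nlinarith
  have hA : 0 < 2 * (c + τ ^ 2) := by positivity
  unfold deltaFn
  rcases lt_or_gt_of_ne (sub_ne_zero.mpr hκτ) with h | h
  · refine (add_lt_add_iff_left 1).mpr
      (mul_lt_mul_of_neg_left (Real.log_lt_log (div_pos hnx hdx) ?_) (div_neg_of_pos_of_neg hA h))
    rw [div_lt_div_iff₀ hdx hdy]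
    nlinarith [mul_pos_of_neg_of_neg h (neg_neg_of_pos hsq)]
  · refine (add_lt_add_iff_left 1).mpr
      (mul_lt_mul_of_pos_left (Real.log_lt_log (div_pos hny hdy) ?_) (div_pos hA h))
    rw [div_lt_div_iff₀ hdy hdx]
    nlinarith [mul_pos h hsq]

/-- An affine function of `x ^ 2` with positive value at `0` and at `x₀` is positive between. -/
theorem add_mul_sq_pos_of_mem_Icc {a b x x₀ : ℝ} (ha : 0 < a) (h : 0 < a + b * x₀ ^ 2)
    (hx : x ∈ Set.Icc 0 x₀) : 0 < a + b * x ^ 2 := by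
  have hsq : x ^ 2 ≤ x₀ ^ 2 := pow_le_pow_left₀ hx.1 hx.2 2
  rcases le_total 0 b with hb | hb
  · positivity
  · nlinarith [mul_le_mul_of_nonpos_left hsq hb]

/-- A zero of `deltaFn`, found by solving for `x ^ 2` the equation expressing that the argument of
the logarithm is `exp (-(κ - 4 * τ ^ 2) / (2 * (c + τ ^ 2)))`. -/
theorem exists_deltaFn_eq_zero {κ τ c : ℝ} (hκτ : κ ≠ 4 * τ ^ 2) (hc : 0 < c) :
    ∃ x₀ : ℝ, 0 < x₀ ∧ 0 < 4 + κ * x₀ ^ 2 ∧ 0 < 4 - (κ - 8 * τ ^ 2) * x₀ ^ 2 ∧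
      deltaFn κ τ c x₀ = 0 := by
  have hd : κ - 4 * τ ^ 2 ≠ 0 := sub_ne_zero.mpr hκτ
  have hA : 0 < 2 * (c + τ ^ 2) := by positivity
  set y : ℝ := (κ - 4 * τ ^ 2) / (2 * (c + τ ^ 2)) with hy_def
  have hy : y ≠ 0 := div_ne_zero hd hA.ne'
  have hyd : y * (2 * (c + τ ^ 2)) = κ - 4 * τ ^ 2 := div_mul_cancel₀ _ hA.ne'
  have hp := one_sub_exp_neg_div_pos hy
  have hle := one_sub_exp_neg_div_le hy
  have he : 0 < Real.exp (-y) := Real.exp_pos _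
  have hpy : (1 - Real.exp (-y)) / y * y = 1 - Real.exp (-y) := div_mul_cancel₀ _ hy
  set e : ℝ := Real.exp (-y) with he_def
  set p : ℝ := (1 - e) / y
  have hden : 0 < (1 + e) * (c + τ ^ 2) - 2 * τ ^ 2 * p := by
    nlinarith [mul_le_mul_of_nonneg_right hle (sq_nonneg τ), mul_pos he hc]
  set t : ℝ := 2 * p / ((1 + e) * (c + τ ^ 2) - 2 * τ ^ 2 * p)
  have ht : 0 < t := by positivity
  have htden : t * ((1 + e) * (c + τ ^ 2) - 2 * τ ^ 2 * p) = 2 * p :=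
    div_mul_cancel₀ _ hden.ne'
  have heq : 4 - (κ - 8 * τ ^ 2) * t = e * (4 + κ * t) := by
    linear_combination (-2 * y) * htden - (4 + 4 * τ ^ 2 * t) * hpy + (1 + e) * t * hyd
  have hpos : 0 < 4 + κ * t := by
    have : (1 + e) * (4 + κ * t) = 8 + 8 * τ ^ 2 * t := by linear_combination -heq
    have hmul : 0 < (1 + e) * (4 + κ * t) := by
      rw [this]
      positivity
    exact (pos_iff_pos_of_mul_pos hmul).mp (by positivity)
  refine ⟨√t, Real.sqrt_pos.mpr ht, ?_⟩
  rw [deltaFn, Real.sq_sqrt ht.le]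
  refine ⟨hpos, heq ▸ mul_pos he hpos, ?_⟩
  rw [heq, mul_div_cancel_right₀ _ hpos.ne', he_def, Real.log_exp, ← inv_div, ← hy_def,
    mul_neg, inv_mul_cancel₀ hy, add_neg_cancel]

/-- There is `x₀ > 0` such that `δ` is well defined and strictly decreasing on `[0,x₀]`,
with `δ(0) = 1`, `δ > 0` on `[0,x₀)` and `δ(x₀) = 0`. -/
theorem delta_strictly_decreasing_to_zero
    (κ τ c : ℝ) (hκτ : κ ≠ 4 * τ ^ 2) (hc : 0 < c) :
    ∃ x₀ : ℝ, 0 < x₀ ∧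
      (∀ x ∈ Set.Icc (0 : ℝ) x₀,
        0 < 4 + κ * x ^ 2 ∧ 0 < 4 - (κ - 8 * τ ^ 2) * x ^ 2) ∧
      StrictAntiOn (deltaFn κ τ c) (Set.Icc 0 x₀) ∧
      deltaFn κ τ c 0 = 1 ∧
      (∀ x ∈ Set.Ico (0 : ℝ) x₀, 0 < deltaFn κ τ c x) ∧
      deltaFn κ τ c x₀ = 0 := by
  obtain ⟨x₀, hx₀, hden, hnum, hzero⟩ := exists_deltaFn_eq_zero hκτ hc
  have hdom : ∀ x ∈ Set.Icc (0 : ℝ) x₀,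
      0 < 4 + κ * x ^ 2 ∧ 0 < 4 - (κ - 8 * τ ^ 2) * x ^ 2 := by
    intro x hx
    rw [sub_eq_add_neg, ← neg_mul] at hnum ⊢
    exact ⟨add_mul_sq_pos_of_mem_Icc four_pos hden hx, add_mul_sq_pos_of_mem_Icc four_pos hnum hx⟩
  have hanti : StrictAntiOn (deltaFn κ τ c) (Set.Icc 0 x₀) := fun x hx y hy hxy =>
    deltaFn_lt_deltaFn hκτ hc hx.1 hxy (hdom x hx).1 (hdom x hx).2 (hdom y hy).1 (hdom y hy).2
  refine ⟨x₀, hx₀, hdom, hanti, deltaFn_zero κ τ c, fun x hx => ?_, hzero⟩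
  rw [← hzero]
  exact hanti (Set.Ico_subset_Icc_self hx) (Set.right_mem_Icc.mpr hx₀.le) hx.2
end

section
/- For every real number c̄ > 0 and every real t > 1/8 with t ≠ 1/4, one has 1 + (2(c̄+t)/(1−4t))·log(8t−1) < 0, where log is the natural logarithm. -/
/-- Lower bound for the logarithm by its first Padé approximant. -/
lemma two_mul_sub_one_div_add_one_le_log {x : ℝ} (hx : 1 ≤ x) :
    2 * (x - 1) / (x + 1) ≤ Real.log x := by
  have h := Real.le_log_one_add_of_nonneg (sub_nonneg.2 hx)
  rwa [add_sub_cancel, show x - 1 + 2 = x + 1 by ring] at h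

/-- Upper bound for the logarithm on `(0, 1]` by its first Padé approximant. -/
lemma log_le_two_mul_sub_one_div_add_one {x : ℝ} (hx : 0 < x) (hx1 : x ≤ 1) :
    Real.log x ≤ 2 * (x - 1) / (x + 1) := by
  have h := two_mul_sub_one_div_add_one_le_log ((one_le_inv₀ hx).2 hx1)
  have e : 2 * (x⁻¹ - 1) / (x⁻¹ + 1) = -(2 * (x - 1) / (x + 1)) := by
    field_simp
    ring
  rw [Real.log_inv, e] at h
  linarith

/-- For every `c̄ > 0` and every `t > 1/8` with `t ≠ 1/4`, one has
`1 + (2(c̄+t)/(1−4t))·log(8t−1) < 0`. -/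
theorem auxiliary_inequality (cbar t : ℝ) (hc : 0 < cbar) (ht : 1 / 8 < t)
    (ht' : t ≠ 1 / 4) :
    1 + (2 * (cbar + t) / (1 - 4 * t)) * Real.log (8 * t - 1) < 0 := by
  have ht0 : 0 < t := by linarith
  have hne : 1 - 4 * t ≠ 0 := fun h => ht' (by linarith)
  have bound : 2 * (cbar + t) / (1 - 4 * t) * Real.log (8 * t - 1) ≤
      2 * (cbar + t) / (1 - 4 * t) * (2 * (8 * t - 1 - 1) / (8 * t - 1 + 1)) := by
    rcases lt_or_gt_of_ne ht' with h | h
    · exact mul_le_mul_of_nonneg_left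
        (log_le_two_mul_sub_one_div_add_one (by linarith) (by linarith))
        (div_nonneg (by linarith) (by linarith))
    · exact mul_le_mul_of_nonpos_left
        (two_mul_sub_one_div_add_one_le_log (by linarith))
        (div_nonpos_of_nonneg_of_nonpos (by linarith) (by linarith))
  have e : 2 * (cbar + t) / (1 - 4 * t) * (2 * (8 * t - 1 - 1) / (8 * t - 1 + 1)) =
      -1 - cbar / t := by
    rw [show 8 * t - 1 + 1 = 8 * t by ring, show 8 * t - 1 - 1 = -2 * (1 - 4 * t) by ring]
    generalize 1 - 4 * t = d at hne ⊢
    field_simp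
    ring
  have hpos : 0 < cbar / t := div_pos hc ht0
  linarith
end

section
/- Fix real numbers κ, τ, c with κ ≠ 4τ² and c > 0. Let 0 < s* ≤ +∞ and let ρ : [0,s*) → ℝ be a C² function with ρ(0) = 0 and ρ'(0) = 1, such that for every s ∈ (0,s*): ρ(s) > 0, 4+κρ(s)² > 0, 4−(κ−8τ²)ρ(s)² > 0, and ρ''(s) = 16ρ(s)(c+τ²) / ( (4+κρ(s)²)(−4+(κ−8τ²)ρ(s)²) ). Then for every s ∈ [0,s*) one has ρ'(s)² = δ(ρ(s)), i.e. ρ'(s)² = 1 + (2(c+τ²)/(κ−4τ²))·log( (4−(κ−8τ²)ρ(s)²)/(4+κρ(s)²) ). -/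
open Set Filter Topology

/-- The derivative of the logarithmic term of the first integral is twice the first derivative of
the profile function times the value which the ODE prescribes for its second derivative. -/
theorem hasDerivAt_log_profile {κ τ c : ℝ} (hκτ : κ ≠ 4 * τ ^ 2) {ρ : ℝ → ℝ} {ρ' x : ℝ}
    (hρ : HasDerivAt ρ ρ' x) (hA : 0 < 4 + κ * ρ x ^ 2)
    (hB : 0 < 4 - (κ - 8 * τ ^ 2) * ρ x ^ 2) :
    HasDerivAt (fun s => (2 * (c + τ ^ 2) / (κ - 4 * τ ^ 2)) *
        Real.log ((4 - (κ - 8 * τ ^ 2) * ρ s ^ 2) / (4 + κ * ρ s ^ 2)))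
      (2 * ρ' * (16 * ρ x * (c + τ ^ 2) /
        ((4 + κ * ρ x ^ 2) * (-4 + (κ - 8 * τ ^ 2) * ρ x ^ 2)))) x := by
  have hk : κ - 4 * τ ^ 2 ≠ 0 := sub_ne_zero.mpr hκτ
  have hnum := ((hρ.pow 2).const_mul (κ - 8 * τ ^ 2)).const_sub 4
  have hden := ((hρ.pow 2).const_mul κ).const_add 4
  have h := ((hnum.div hden hA.ne').log (div_pos hB hA).ne').const_mul
    (2 * (c + τ ^ 2) / (κ - 4 * τ ^ 2))
  refine h.congr_deriv ?_
  have hflip : -4 + (κ - 8 * τ ^ 2) * ρ x ^ 2 = -(4 - (κ - 8 * τ ^ 2) * ρ x ^ 2) := by ring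
  simp only [Pi.div_apply, Pi.pow_apply, hflip]
  have hA' := hA.ne'
  have hB' := hB.ne'
  generalize hBeq : 4 - (κ - 8 * τ ^ 2) * ρ x ^ 2 = B at hB' ⊢
  generalize hkeq : κ - 4 * τ ^ 2 = k at hk ⊢
  field_simp
  rw [← hBeq, ← hkeq]
  ring

/-- First integral of the ODE satisfied by the profile function of the rotational
surface of constant extrinsic curvature `c > 0` in `E³(κ,τ)`: the square of the angle
function `ρ'(s)` equals `δ(ρ(s))`. -/
theorem angle_first_integral
    (κ τ c : ℝ) (hκτ : κ ≠ 4 * τ ^ 2) (hc : 0 < c)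
    (J : Set ℝ) (hJ : (∃ sStar : ℝ, 0 < sStar ∧ J = Set.Ico 0 sStar) ∨ J = Set.Ici 0)
    (ρ : ℝ → ℝ) (hρ : ContDiffOn ℝ 2 ρ J)
    (hρ0 : ρ 0 = 0) (hρ'0 : derivWithin ρ (Set.Ici 0) 0 = 1)
    (hODE : ∀ s ∈ J \ {0},
      0 < ρ s ∧ 0 < 4 + κ * ρ s ^ 2 ∧ 0 < 4 - (κ - 8 * τ ^ 2) * ρ s ^ 2 ∧
      derivWithin (derivWithin ρ (Set.Ici 0)) (Set.Ici 0) s =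
        16 * ρ s * (c + τ ^ 2) /
          ((4 + κ * ρ s ^ 2) * (-4 + (κ - 8 * τ ^ 2) * ρ s ^ 2))) :
    ∀ s ∈ J, (derivWithin ρ (Set.Ici 0) s) ^ 2 =
      1 + (2 * (c + τ ^ 2) / (κ - 4 * τ ^ 2)) *
        Real.log ((4 - (κ - 8 * τ ^ 2) * ρ s ^ 2) / (4 + κ * ρ s ^ 2)) := by
  have hJ0 : ∀ s ∈ J, 0 ≤ s := by
    rcases hJ with ⟨b, -, rfl⟩ | rfl
    exacts [fun s hs => hs.1, fun s hs => hs]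
  have hIcc : ∀ s ∈ J, Icc 0 s ⊆ J := by
    rcases hJ with ⟨b, -, rfl⟩ | rfl
    exacts [fun s hs x hx => ⟨hx.1, hx.2.trans_lt hs.2⟩, fun s hs x hx => hx.1]
  have hnhds : ∀ s ∈ J, J =ᶠ[𝓝 s] Ici 0 := by
    rcases hJ with ⟨b, -, rfl⟩ | rfl
    · intro s hs
      filter_upwards [Iio_mem_nhds hs.2] with x hx
      exact propext ⟨fun h => h.1, fun h => ⟨h, hx⟩⟩
    · exact fun s _ => EventuallyEq.rfl
  have hJu : UniqueDiffOn ℝ J := by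
    rcases hJ with ⟨b, -, rfl⟩ | rfl
    exacts [uniqueDiffOn_Ico 0 b, uniqueDiffOn_Ici 0]
  set d := derivWithin ρ (Ici 0) with hd
  have hdJ : EqOn d (derivWithin ρ J) J := fun s hs => (derivWithin_congr_set (hnhds s hs)).symm
  have hd_diff : DifferentiableOn ℝ d J :=
    ((hρ.derivWithin hJu (m := 1) (by norm_num)).differentiableOn (by norm_num)).congr hdJ
  have hρ_diff : DifferentiableOn ℝ ρ J := hρ.differentiableOn (by norm_num)
  have hpos : ∀ s ∈ J, 0 < 4 + κ * ρ s ^ 2 ∧ 0 < 4 - (κ - 8 * τ ^ 2) * ρ s ^ 2 := by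
    intro s hs
    rcases eq_or_ne s 0 with rfl | h0
    · norm_num [hρ0]
    · exact ⟨(hODE s ⟨hs, h0⟩).2.1, (hODE s ⟨hs, h0⟩).2.2.1⟩
  have hderiv : ∀ f : ℝ → ℝ, DifferentiableOn ℝ f J → ∀ s ∈ J, 0 < s →
      HasDerivAt f (derivWithin f (Ici 0) s) s := by
    intro f hf s hs h0
    have hmem : J ∈ 𝓝 s := by
      filter_upwards [hnhds s hs, Ici_mem_nhds h0] with x hx hx0
      exact (iff_of_eq hx).mpr hx0
    rw [derivWithin_of_mem_nhds (Ici_mem_nhds h0)]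
    exact (hf.differentiableAt hmem).hasDerivAt
  intro s hs
  set L : ℝ → ℝ := fun s => (2 * (c + τ ^ 2) / (κ - 4 * τ ^ 2)) *
    Real.log ((4 - (κ - 8 * τ ^ 2) * ρ s ^ 2) / (4 + κ * ρ s ^ 2)) with hL
  have hL0 : L 0 = 0 := by simp [hL, hρ0]
  rcases (hJ0 s hs).eq_or_lt with rfl | hs0
  · change d 0 ^ 2 = 1 + L 0
    rw [hL0, hρ'0]
    norm_num
  have hρc : ContinuousOn ρ J := hρ_diff.continuousOn
  have hLc : ContinuousOn L J := by
    refine continuousOn_const.mul (ContinuousOn.log (ContinuousOn.div (by fun_prop) (by fun_prop)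
      fun x hx => (hpos x hx).1.ne') fun x hx => (div_pos (hpos x hx).2 (hpos x hx).1).ne')
  have hFc : ContinuousOn (fun x => d x ^ 2 - L x) (Icc 0 s) :=
    ((hd_diff.continuousOn.pow 2).sub hLc).mono (hIcc s hs)
  have hF' : ∀ x ∈ Ioo 0 s, HasDerivAt (fun x => d x ^ 2 - L x) 0 x := by
    intro x hx
    have hxJ := hIcc s hs (Ioo_subset_Icc_self hx)
    have h2 := (hODE x ⟨hxJ, hx.1.ne'⟩).2.2.2
    have hdx := hderiv d hd_diff x hxJ hx.1
    rw [h2] at hdx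
    have hLx := hasDerivAt_log_profile (c := c) hκτ (hderiv ρ hρ_diff x hxJ hx.1)
      (hpos x hxJ).1 (hpos x hxJ).2
    refine ((hdx.pow 2).sub hLx).congr_deriv ?_
    norm_num [hd]
  obtain ⟨_, -, hslope⟩ := exists_hasDerivAt_eq_slope _ (fun _ => 0) hs0 hFc hF'
  rw [eq_div_iff (by linarith)] at hslope
  simp only [hL0, hρ'0] at hslope
  change d s ^ 2 = 1 + L s
  linarith
end

section
/- Fix real numbers κ, τ, c with κ ≠ 4τ² and c > 0, and define ϕ(x) = δ(x) − 1/(1+τ²x²) on the domain of δ. Then ϕ(0) = 0 and ϕ'(x) < 0 for every x > 0 in the domain of δ (i.e. with 4+κx² > 0 and 4−(κ−8τ²)x² > 0). -/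
open Set Filter Topology

/-- The comparison function `ϕ(x) = δ(x) − 1/(1+τ²x²)`. -/
noncomputable def phiFn (κ τ c x : ℝ) : ℝ :=
  deltaFn κ τ c x - 1 / (1 + τ ^ 2 * x ^ 2)

/-- The derivative of `δ` on its domain. -/
lemma hasDerivAt_deltaFn {κ τ x : ℝ} (c : ℝ) (hκτ : κ ≠ 4 * τ ^ 2)
    (hB : 0 < 4 + κ * x ^ 2) (hA : 0 < 4 - (κ - 8 * τ ^ 2) * x ^ 2) :
    HasDerivAt (deltaFn κ τ c)
      (-(32 * (c + τ ^ 2) * x / ((4 - (κ - 8 * τ ^ 2) * x ^ 2) * (4 + κ * x ^ 2)))) x := by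
  have hsq : HasDerivAt (fun y : ℝ => y ^ 2) (2 * x) x := by
    simpa using hasDerivAt_pow 2 x
  have hκ : κ - 4 * τ ^ 2 ≠ 0 := sub_ne_zero.mpr hκτ
  have h := ((((hsq.const_mul (κ - 8 * τ ^ 2)).const_sub 4).div
    ((hsq.const_mul κ).const_add 4) hB.ne').log (div_pos hA hB).ne').const_mul
      (2 * (c + τ ^ 2) / (κ - 4 * τ ^ 2)) |>.const_add 1
  refine h.congr_deriv ?_
  simp only [Pi.div_apply]
  rw [div_div_div_eq, div_mul_div_comm, ← neg_div, div_eq_div_iff (by positivity) (by positivity)]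
  ring

/-- The derivative of the bound `1/(1+τ²x²)`. -/
lemma hasDerivAt_one_div_one_add_sq (τ x : ℝ) :
    HasDerivAt (fun y : ℝ => 1 / (1 + τ ^ 2 * y ^ 2))
      (-(2 * τ ^ 2 * x / (1 + τ ^ 2 * x ^ 2) ^ 2)) x := by
  have hsq : HasDerivAt (fun y : ℝ => y ^ 2) (2 * x) x := by
    simpa using hasDerivAt_pow 2 x
  have h0 : 1 + τ ^ 2 * x ^ 2 ≠ 0 := by positivity
  have h := (hasDerivAt_const x (1 : ℝ)).div ((hsq.const_mul (τ ^ 2)).const_add 1) h0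
  refine h.congr_deriv ?_
  rw [← neg_div]
  ring

/-- `ϕ(0) = 0` and `ϕ' < 0` at every `x > 0` in the domain of `δ`. -/
theorem phi_decreasing (κ τ c : ℝ) (hκτ : κ ≠ 4 * τ ^ 2) (hc : 0 < c) :
    phiFn κ τ c 0 = 0 ∧
    ∀ x : ℝ, 0 < x → 0 < 4 + κ * x ^ 2 → 0 < 4 - (κ - 8 * τ ^ 2) * x ^ 2 →
      deriv (phiFn κ τ c) x < 0 := by
  refine ⟨by simp [phiFn, deltaFn], fun x hx hB hA => ?_⟩
  have hderiv := (hasDerivAt_deltaFn c hκτ hB hA).sub (hasDerivAt_one_div_one_add_sq τ x)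
  have hprod : (4 - (κ - 8 * τ ^ 2) * x ^ 2) * (4 + κ * x ^ 2) ≤
      16 * (1 + τ ^ 2 * x ^ 2) ^ 2 := by
    linarith [sq_nonneg ((κ - 4 * τ ^ 2) * x ^ 2)]
  have hδ : 32 * (c + τ ^ 2) * x / (16 * (1 + τ ^ 2 * x ^ 2) ^ 2) ≤
      32 * (c + τ ^ 2) * x / ((4 - (κ - 8 * τ ^ 2) * x ^ 2) * (4 + κ * x ^ 2)) :=
    div_le_div_of_nonneg_left (by positivity) (mul_pos hA hB) hprod
  have hlt : 2 * τ ^ 2 * x / (1 + τ ^ 2 * x ^ 2) ^ 2 <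
      32 * (c + τ ^ 2) * x / (16 * (1 + τ ^ 2 * x ^ 2) ^ 2) := by
    rw [div_lt_div_iff₀ (by positivity) (by positivity)]
    have : 0 < c * x * (1 + τ ^ 2 * x ^ 2) ^ 2 := by positivity
    linarith
  have heq : deriv (phiFn κ τ c) x = _ := hderiv.deriv
  rw [heq]
  linarith
end

section
/- Let κ > 0 and let ρ : [0,∞) → ℝ be a C² function such that ρ' is strictly decreasing on [0,∞), 0 < ρ'(s) < 1 for all s > 0, and ρ(s) → ∞ as s → ∞. Define, for s > 0, Q(s) = ( (4−κρ(s)²)²(1−ρ'(s)²)² + ρ''(s)²ρ(s)²(4+κρ(s)²)² ) / ( 16ρ(s)²(1−ρ'(s)²) ). Then Q is unbounded on (0,∞). -/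
open Set Filter Topology

/-- The squared norm of the second fundamental form of a non-slice rotational entire
graph in `S²(κ)×ℝ` with strictly monotone angle function is unbounded. -/
theorem second_fundamental_form_unbounded
    (κ : ℝ) (hκ : 0 < κ)
    (ρ : ℝ → ℝ) (hρ : ContDiffOn ℝ 2 ρ (Set.Ici 0))
    (hmono : StrictAntiOn (derivWithin ρ (Set.Ici 0)) (Set.Ici 0))
    (hρ' : ∀ s : ℝ, 0 < s →
      0 < derivWithin ρ (Set.Ici 0) s ∧ derivWithin ρ (Set.Ici 0) s < 1)
    (hinf : Tendsto ρ atTop atTop)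
    (Q : ℝ → ℝ)
    (hQ : ∀ s : ℝ, 0 < s → Q s =
      ((4 - κ * ρ s ^ 2) ^ 2 * (1 - (derivWithin ρ (Set.Ici 0) s) ^ 2) ^ 2 +
        (derivWithin (derivWithin ρ (Set.Ici 0)) (Set.Ici 0) s) ^ 2 * ρ s ^ 2 *
          (4 + κ * ρ s ^ 2) ^ 2) /
      (16 * ρ s ^ 2 * (1 - (derivWithin ρ (Set.Ici 0) s) ^ 2))) :
    ∀ C : ℝ, ∃ s : ℝ, 0 < s ∧ C < Q s := by
  intro C
  obtain ⟨ha0, ha1⟩ := hρ' 1 one_pos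
  have hδ : 0 < 1 - derivWithin ρ (Set.Ici 0) 1 ^ 2 := by nlinarith
  have hsq : Tendsto (fun s => ρ s ^ 2) atTop atTop :=
    (tendsto_pow_atTop two_ne_zero).comp hinf
  obtain ⟨s, hs1, hs8, hsC⟩ := ((eventually_ge_atTop (1 : ℝ)).and
    ((hsq.eventually_ge_atTop (8 / κ)).and (hsq.eventually_gt_atTop
      (64 * C / (κ ^ 2 * (1 - derivWithin ρ (Set.Ici 0) 1 ^ 2)))))).exists
  have hs : 0 < s := one_pos.trans_le hs1
  refine ⟨s, hs, ?_⟩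
  rw [hQ s hs]
  obtain ⟨hd0, -⟩ := hρ' s hs
  have hda := hmono.antitoneOn (mem_Ici.2 zero_le_one) (mem_Ici.2 hs.le) hs1
  generalize derivWithin (derivWithin ρ (Set.Ici 0)) (Set.Ici 0) s = e
  generalize derivWithin ρ (Set.Ici 0) s = d at *
  generalize derivWithin ρ (Set.Ici 0) 1 = a at *
  have hr : 0 < ρ s ^ 2 := (div_pos (by norm_num) hκ).trans_le hs8
  generalize ρ s ^ 2 = r at *
  rw [div_le_iff₀ hκ] at hs8
  rw [div_lt_iff₀ (by positivity)] at hsC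
  have hδd : 1 - a ^ 2 ≤ 1 - d ^ 2 := by nlinarith
  generalize 1 - d ^ 2 = t at *
  generalize 1 - a ^ 2 = δ at *
  have ht : 0 < t := hδ.trans_le hδd
  rw [lt_div_iff₀ (by positivity)]
  have hC : 64 * C < r * (κ ^ 2 * t) := hsC.trans_le (by gcongr)
  have hlow : (κ * r / 2) ^ 2 ≤ (4 - κ * r) ^ 2 := by nlinarith
  calc C * (16 * r * t) = 64 * C * (r * t / 4) := by ring
    _ < r * (κ ^ 2 * t) * (r * t / 4) := by gcongr
    _ = (κ * r / 2) ^ 2 * t ^ 2 := by ring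
    _ ≤ (4 - κ * r) ^ 2 * t ^ 2 := by gcongr
    _ ≤ _ := le_add_of_nonneg_right (by positivity)
end

section
/- Let τ ≠ 0 and a ∈ ℝ. Let h : (0,∞) → ℝ be a differentiable function and define γ : (0,∞) → ℝ² by γ(ρ) = ( ρ, cos(h(ρ)/τ) ) / ( √(1+ρ²) − sin(h(ρ)/τ) ) (the denominator is positive for every ρ > 0). Suppose (ρ_n) is a sequence with ρ_n → ∞, h(ρ_n) → a, and ρ_n·h'(ρ_n) → 0. Then γ'(ρ_n)/‖γ'(ρ_n)‖ → ( −sin(a/τ), −cos(a/τ) ) as n → ∞. -/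
open Set Filter Topology

/-- The velocity at `ρ` of the stereographic profile curve of a graph, rescaled by a positive
factor, where `u = ρ⁻¹`, `y = h ρ / τ` and `q = ρ * (deriv h ρ / τ)`. Unlike the velocity itself,
it is continuous up to `u = 0`. -/
noncomputable def profileDirection (u y q : ℝ) : EuclideanSpace ℝ (Fin 2) :=
  (WithLp.equiv 2 (Fin 2 → ℝ)).symm
    ![u / √(1 + u ^ 2) - Real.sin y + Real.cos y * q,
      u * q - Real.sin y * q * √(1 + u ^ 2) - Real.cos y / √(1 + u ^ 2)]

theorem sqrt_one_add_sq_sub_sin_pos {ρ : ℝ} (hρ : 0 < ρ) (y : ℝ) :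
    0 < √(1 + ρ ^ 2) - Real.sin y := by
  have : 1 < √(1 + ρ ^ 2) := Real.lt_sqrt_of_sq_lt (by nlinarith)
  linarith [Real.sin_le_one y]

theorem hasDerivAt_profile {f : ℝ → ℝ} {p ρ : ℝ} (hρ : 0 < ρ) (hf : HasDerivAt f p ρ) :
    HasDerivAt (fun r => (√(1 + r ^ 2) - Real.sin (f r))⁻¹ •
        (WithLp.equiv 2 (Fin 2 → ℝ)).symm ![r, Real.cos (f r)])
      (((√(1 + ρ ^ 2) - Real.sin (f ρ)) ^ 2)⁻¹ • profileDirection ρ⁻¹ (f ρ) (ρ * p)) ρ := by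
  have hD := sqrt_one_add_sq_sub_sin_pos hρ (f ρ)
  have hW : 0 < √(1 + ρ ^ 2) := by positivity
  have hWsq : √(1 + ρ ^ 2) ^ 2 = 1 + ρ ^ 2 := Real.sq_sqrt (by positivity)
  have hQ : √(1 + ρ⁻¹ ^ 2) = √(1 + ρ ^ 2) / ρ := by
    rw [show 1 + ρ⁻¹ ^ 2 = (1 + ρ ^ 2) / ρ ^ 2 by field_simp; ring,
      Real.sqrt_div (by positivity), Real.sqrt_sq hρ.le]
  have hsc := Real.sin_sq_add_cos_sq (f ρ)
  have hsqrt : HasDerivAt (fun r : ℝ => √(1 + r ^ 2)) (ρ / √(1 + ρ ^ 2)) ρ := by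
    convert ((hasDerivAt_pow 2 ρ).const_add 1).sqrt (by positivity) using 1
    field_simp
    simp [mul_comm]
  have hinv : HasDerivAt (fun r => (√(1 + r ^ 2) - Real.sin (f r))⁻¹)
      (-(ρ / √(1 + ρ ^ 2) - Real.cos (f ρ) * p) / (√(1 + ρ ^ 2) - Real.sin (f ρ)) ^ 2) ρ :=
    (hsqrt.sub hf.sin).inv hD.ne'
  refine (EuclideanSpace.equiv (Fin 2) ℝ).symm.hasFDerivAt.comp_hasDerivAt
    (f := fun r => WithLp.equiv 2 (Fin 2 → ℝ) ((√(1 + r ^ 2) - Real.sin (f r))⁻¹ •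
      (WithLp.equiv 2 (Fin 2 → ℝ)).symm ![r, Real.cos (f r)]))
    (f' := WithLp.equiv 2 (Fin 2 → ℝ)
      (((√(1 + ρ ^ 2) - Real.sin (f ρ)) ^ 2)⁻¹ • profileDirection ρ⁻¹ (f ρ) (ρ * p)))
    ρ (hasDerivAt_pi.2 fun i => ?_)
  fin_cases i
  · refine (hinv.mul (hasDerivAt_id ρ)).congr_deriv ?_
    simp only [profileDirection, hQ]
    simp
    generalize √(1 + ρ ^ 2) = W at *
    generalize Real.sin (f ρ) = s at *
    field_simp
    linear_combination hWsq
  · refine (hinv.mul hf.cos).congr_deriv ?_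
    simp only [profileDirection, hQ]
    simp
    generalize √(1 + ρ ^ 2) = W at *
    generalize Real.sin (f ρ) = s at *
    field_simp
    linear_combination (W * p) * hsc

theorem tendsto_profileDirection {α : Type*} {l : Filter α} {u y q : α → ℝ} {u₀ y₀ q₀ : ℝ}
    (hu : Tendsto u l (𝓝 u₀)) (hy : Tendsto y l (𝓝 y₀)) (hq : Tendsto q l (𝓝 q₀)) :
    Tendsto (fun x => profileDirection (u x) (y x) (q x)) l (𝓝 (profileDirection u₀ y₀ q₀)) := by
  have hs := (Real.continuous_sin.tendsto y₀).comp hy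
  have hc := (Real.continuous_cos.tendsto y₀).comp hy
  have hQ : Tendsto (fun x => √(1 + u x ^ 2)) l (𝓝 √(1 + u₀ ^ 2)) :=
    ((hu.pow 2).const_add 1).sqrt
  have hne : √(1 + u₀ ^ 2) ≠ 0 := by positivity
  refine ((PiLp.continuous_toLp 2 _).tendsto _).comp (tendsto_pi_nhds.2 fun i => ?_)
  fin_cases i
  · exact ((hu.div hQ hne).sub hs).add (hc.mul hq)
  · exact ((hu.mul hq).sub ((hs.mul hq).mul hQ)).sub (hc.div hQ hne)

theorem profileDirection_zero (y : ℝ) :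
    profileDirection 0 y 0 =
      (WithLp.equiv 2 (Fin 2 → ℝ)).symm ![-Real.sin y, -Real.cos y] := by
  simp [profileDirection]

theorem norm_profileDirection_zero (y : ℝ) : ‖profileDirection 0 y 0‖ = 1 := by
  simp [profileDirection, EuclideanSpace.norm_eq]

theorem inv_norm_smul_pos_smul {E : Type*} [SeminormedAddCommGroup E] [NormedSpace ℝ E]
    {c : ℝ} (hc : 0 < c) (v : E) : ‖c • v‖⁻¹ • c • v = ‖v‖⁻¹ • v := by
  rw [norm_smul, Real.norm_of_nonneg hc.le, smul_smul, mul_inv_rev, mul_assoc,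
    inv_mul_cancel₀ hc.ne', mul_one]

/-- Limit unit tangent direction of the profile curve, in stereographic coordinates on
the Berger sphere, of a rotational entire graph `x₃ = h(ρ)`, along a sequence
`ρ_n → ∞` with `h(ρ_n) → a` and `ρ_n·h'(ρ_n) → 0`. -/
theorem limit_tangent_direction
    (τ a : ℝ) (hτ : τ ≠ 0)
    (h : ℝ → ℝ) (hdiff : ∀ ρ : ℝ, 0 < ρ → DifferentiableAt ℝ h ρ)
    (γ : ℝ → EuclideanSpace ℝ (Fin 2))
    (hγ : ∀ ρ : ℝ, 0 < ρ →
      γ ρ = (Real.sqrt (1 + ρ ^ 2) - Real.sin (h ρ / τ))⁻¹ •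
        (WithLp.equiv 2 (Fin 2 → ℝ)).symm ![ρ, Real.cos (h ρ / τ)])
    (ρn : ℕ → ℝ) (hρn : Tendsto ρn atTop atTop)
    (hha : Tendsto (fun n => h (ρn n)) atTop (𝓝 a))
    (hh' : Tendsto (fun n => ρn n * deriv h (ρn n)) atTop (𝓝 0)) :
    Tendsto (fun n => ‖deriv γ (ρn n)‖⁻¹ • deriv γ (ρn n)) atTop
      (𝓝 ((WithLp.equiv 2 (Fin 2 → ℝ)).symm
        ![-Real.sin (a / τ), -Real.cos (a / τ)])) := by
  have hdir : Tendsto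
      (fun n => profileDirection (ρn n)⁻¹ (h (ρn n) / τ) (ρn n * (deriv h (ρn n) / τ))) atTop
      (𝓝 (profileDirection 0 (a / τ) 0)) := by
    have hq : Tendsto (fun n => ρn n * (deriv h (ρn n) / τ)) atTop (𝓝 0) := by
      simpa [mul_div_assoc] using hh'.div_const τ
    exact tendsto_profileDirection (tendsto_inv_atTop_zero.comp hρn) (hha.div_const τ) hq
  have hnorm : Tendsto (fun n => ‖profileDirection (ρn n)⁻¹ (h (ρn n) / τ)
      (ρn n * (deriv h (ρn n) / τ))‖⁻¹ • profileDirection (ρn n)⁻¹ (h (ρn n) / τ)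
      (ρn n * (deriv h (ρn n) / τ))) atTop _ :=
    (hdir.norm.inv₀ (by simp [norm_profileDirection_zero])).smul hdir
  rw [norm_profileDirection_zero, inv_one, one_smul, profileDirection_zero] at hnorm
  refine hnorm.congr' ?_
  filter_upwards [hρn.eventually_gt_atTop 0] with n hn
  have hderiv : HasDerivAt γ _ (ρn n) :=
    (hasDerivAt_profile hn ((hdiff _ hn).hasDerivAt.div_const τ)).congr_of_eventuallyEq
      (by filter_upwards [eventually_gt_nhds hn] with r hr using hγ r hr)
  have hD := sqrt_one_add_sq_sub_sin_pos hn (h (ρn n) / τ)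
  rw [hderiv.deriv, inv_norm_smul_pos_smul (by positivity)]
end

section
/- Let R = 1/20 and define h(ρ) = (R/2)ρ² + ((R/6 + R³)/8)ρ⁴. For ρ ∈ (0,π) define κ₁(ρ) = h''(ρ)/(1+h'(ρ)²)^{3/2} and κ₂(ρ) = h'(ρ)·(cos ρ/sin ρ)/√(1+h'(ρ)²). Then: (1) h(0) = h'(0) = 0 and h''(0) = R > 0; (2) h''(ρ) > 0 for every ρ ∈ (0,π); (3) κ₁'(ρ)·κ₂'(ρ) < 0 for every ρ ∈ (0,π); (4) κ₁'(ρ)/κ₂'(ρ) → −1 as ρ → 0⁺. -/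
open Set Filter Topology

/-- `R = 1/20`. -/
noncomputable def Rconst : ℝ := 1 / 20

/-- `h(ρ) = (R/2)ρ² + ((R/6 + R³)/8)ρ⁴` with `R = 1/20`. -/
noncomputable def hFn (ρ : ℝ) : ℝ :=
  (Rconst / 2) * ρ ^ 2 + ((Rconst / 6 + Rconst ^ 3) / 8) * ρ ^ 4

/-- Principal curvature `κ₁(ρ) = h''(ρ)/(1+h'(ρ)²)^{3/2}` of the rotational surface in
`S²×ℝ` with profile `h`. -/
noncomputable def kappa1 (ρ : ℝ) : ℝ :=
  deriv (deriv hFn) ρ / (1 + (deriv hFn ρ) ^ 2) ^ ((3 : ℝ) / 2)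

/-- Principal curvature `κ₂(ρ) = h'(ρ)·cot(ρ)/√(1+h'(ρ)²)` of the rotational surface in
`S²×ℝ` with profile `h`. -/
noncomputable def kappa2 (ρ : ℝ) : ℝ :=
  deriv hFn ρ * (Real.cos ρ / Real.sin ρ) / Real.sqrt (1 + (deriv hFn ρ) ^ 2)

/-- Derivative of the meridian curvature of a graph with slope `p` and second derivative `q`. -/
theorem hasDerivAt_meridianCurvature {p q : ℝ → ℝ} {r x : ℝ}
    (hp : HasDerivAt p (q x) x) (hq : HasDerivAt q r x) :
    HasDerivAt (fun t => q t / (1 + p t ^ 2) ^ ((3 : ℝ) / 2))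
      ((r * (1 + p x ^ 2) - 3 * p x * q x ^ 2) / √(1 + p x ^ 2) ^ 5) x := by
  have hpow : ∀ t, (1 + p t ^ 2) ^ ((3 : ℝ) / 2) = √(1 + p t ^ 2) ^ 3 := fun t => by
    rw [Real.sqrt_eq_rpow, ← Real.rpow_natCast _ 3, ← Real.rpow_mul (by positivity)]
    norm_num
  simp only [hpow]
  have hW : 0 < 1 + p x ^ 2 := by positivity
  have hs : 0 < √(1 + p x ^ 2) := Real.sqrt_pos.2 hW
  have hsq : √(1 + p x ^ 2) ^ 2 = 1 + p x ^ 2 := Real.sq_sqrt hW.le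
  have hd := hq.div ((((hp.pow 2).const_add 1).sqrt hW.ne').pow 3) (pow_ne_zero 3 hs.ne')
  refine hd.congr_deriv ?_
  simp only [Pi.pow_apply]
  generalize √(1 + p x ^ 2) = s at hs hsq
  rw [← hsq]
  field_simp
  ring

/-- Derivative of the parallel curvature of a rotational graph in `S² × ℝ` with slope `p`. -/
theorem hasDerivAt_parallelCurvature {p : ℝ → ℝ} {q x : ℝ}
    (hp : HasDerivAt p q x) (hx : Real.sin x ≠ 0) :
    HasDerivAt (fun t => p t * (Real.cos t / Real.sin t) / √(1 + p t ^ 2))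
      ((q * (Real.sin x * Real.cos x) - p x * (1 + p x ^ 2)) /
        (√(1 + p x ^ 2) ^ 3 * Real.sin x ^ 2)) x := by
  have hW : 0 < 1 + p x ^ 2 := by positivity
  have hs : 0 < √(1 + p x ^ 2) := Real.sqrt_pos.2 hW
  have hsq : √(1 + p x ^ 2) ^ 2 = 1 + p x ^ 2 := Real.sq_sqrt hW.le
  have hd := (hp.mul ((Real.hasDerivAt_cos x).div (Real.hasDerivAt_sin x) hx)).div
    (((hp.pow 2).const_add 1).sqrt hW.ne') hs.ne'
  refine hd.congr_deriv ?_
  simp only [Pi.pow_apply, Pi.mul_apply, Pi.div_apply]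
  have htrig := Real.sin_sq_add_cos_sq x
  generalize √(1 + p x ^ 2) = s at hs hsq
  generalize Real.sin x = a at *
  generalize Real.cos x = b at *
  generalize p x = u at *
  rw [← hsq]
  field_simp
  push_cast
  linear_combination (-2 * s ^ 2 * u) * htrig + 2 * q * a * b * hsq

theorem deriv_hFn : deriv hFn = fun ρ => ρ / 20 + 203 / 48000 * ρ ^ 3 := by
  funext ρ
  have hd := ((hasDerivAt_pow 2 ρ).const_mul (Rconst / 2)).add
    ((hasDerivAt_pow 4 ρ).const_mul ((Rconst / 6 + Rconst ^ 3) / 8))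
  refine (hd.congr_deriv ?_).deriv
  norm_num [Rconst]
  ring

theorem hasDerivAt_deriv_hFn (ρ : ℝ) :
    HasDerivAt (deriv hFn) (1 / 20 + 203 / 16000 * ρ ^ 2) ρ := by
  rw [deriv_hFn]
  refine (((hasDerivAt_id ρ).div_const 20).add
    ((hasDerivAt_pow 3 ρ).const_mul (203 / 48000))).congr_deriv ?_
  norm_num
  ring

theorem deriv_deriv_hFn : deriv (deriv hFn) = fun ρ => 1 / 20 + 203 / 16000 * ρ ^ 2 :=
  funext fun ρ => (hasDerivAt_deriv_hFn ρ).deriv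

theorem hasDerivAt_deriv_deriv_hFn (ρ : ℝ) :
    HasDerivAt (deriv (deriv hFn)) (203 / 8000 * ρ) ρ := by
  rw [deriv_deriv_hFn]
  refine (((hasDerivAt_pow 2 ρ).const_mul (203 / 16000)).const_add (1 / 20)).congr_deriv ?_
  norm_num
  ring

theorem deriv_kappa1 (ρ : ℝ) :
    deriv kappa1 ρ =
      (203 / 8000 * ρ * (1 + deriv hFn ρ ^ 2) - 3 * deriv hFn ρ * deriv (deriv hFn) ρ ^ 2) /
        √(1 + deriv hFn ρ ^ 2) ^ 5 := by
  refine (hasDerivAt_meridianCurvature ?_ (hasDerivAt_deriv_deriv_hFn ρ)).deriv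
  exact (hasDerivAt_deriv_hFn ρ).differentiableAt.hasDerivAt

theorem deriv_kappa2 {ρ : ℝ} (hρ : Real.sin ρ ≠ 0) :
    deriv kappa2 ρ =
      (deriv (deriv hFn) ρ * (Real.sin ρ * Real.cos ρ) -
          deriv hFn ρ * (1 + deriv hFn ρ ^ 2)) /
        (√(1 + deriv hFn ρ ^ 2) ^ 3 * Real.sin ρ ^ 2) :=
  (hasDerivAt_parallelCurvature (hasDerivAt_deriv_hFn ρ).differentiableAt.hasDerivAt hρ).deriv

theorem sq_lt_ten_of_mem_Ioo_pi {ρ : ℝ} (hρ : ρ ∈ Ioo 0 Real.pi) : ρ ^ 2 < 10 := by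
  have hπ := Real.pi_lt_d2
  nlinarith [hρ.1, hρ.2]

theorem deriv_kappa1_pos {ρ : ℝ} (hρ : ρ ∈ Ioo 0 Real.pi) : 0 < deriv kappa1 ρ := by
  rw [deriv_kappa1]
  refine div_pos ?_ (by positivity)
  rw [deriv_deriv_hFn, deriv_hFn]
  have hx := sq_lt_ten_of_mem_Ioo_pi hρ
  have hρ0 := hρ.1
  have key : 3 * (1 / 20 + 203 / 48000 * ρ ^ 2) * (1 / 20 + 203 / 16000 * ρ ^ 2) ^ 2 <
      203 / 8000 := by
    calc 3 * (1 / 20 + 203 / 48000 * ρ ^ 2) * (1 / 20 + 203 / 16000 * ρ ^ 2) ^ 2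
        ≤ 3 * (1 / 20 + 203 / 48000 * 10) * (1 / 20 + 203 / 16000 * 10) ^ 2 := by gcongr
      _ < 203 / 8000 := by norm_num
  have hprod := mul_lt_mul_of_pos_left key hρ0
  have : 0 ≤ 203 / 8000 * ρ * (ρ / 20 + 203 / 48000 * ρ ^ 3) ^ 2 := by positivity
  simp only
  linarith

theorem deriv_kappa2_neg {ρ : ℝ} (hρ : ρ ∈ Ioo 0 Real.pi) : deriv kappa2 ρ < 0 := by
  have hsin := Real.sin_pos_of_mem_Ioo hρ
  rw [deriv_kappa2 hsin.ne']
  refine div_neg_of_neg_of_pos ?_ (by positivity)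
  rw [deriv_deriv_hFn, deriv_hFn]
  have hρ0 := hρ.1
  have hp : 0 < ρ / 20 + 203 / 48000 * ρ ^ 3 := by positivity
  have hp3 := pow_pos hp 3
  have hq : 0 < 1 / 20 + 203 / 16000 * ρ ^ 2 := by positivity
  simp only
  rcases le_or_gt (Real.cos ρ) 0 with hcos | hcos
  · have := mul_nonneg hq.le (mul_nonneg hsin.le (neg_nonneg.2 hcos))
    nlinarith
  · have hcos' : Real.cos ρ ≤ 1 - 1 / 5 * ρ ^ 2 := by
      refine (Real.cos_le_one_sub_mul_cos_sq (abs_le.2 ⟨by linarith [hρ.2], hρ.2.le⟩)).trans ?_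
      have hπ : Real.pi ^ 2 < 10 := by nlinarith [Real.pi_lt_d2, Real.pi_pos]
      have : 1 / 5 ≤ 2 / Real.pi ^ 2 := by
        rw [div_le_div_iff₀ (by norm_num) (by positivity)]
        linarith
      nlinarith [sq_nonneg ρ]
    have hsc : Real.sin ρ * Real.cos ρ ≤ ρ * (1 - 1 / 5 * ρ ^ 2) :=
      mul_le_mul (Real.sin_lt hρ0).le hcos' hcos.le hρ0.le
    have := mul_le_mul_of_nonneg_left hsc hq.le
    have h3 := pow_pos hρ0 3
    have h5 := pow_pos hρ0 5
    nlinarith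

theorem abs_sin_mul_cos_sub_le {ρ : ℝ} (hρ : |ρ| ≤ 1 / 2) :
    |Real.sin ρ * Real.cos ρ - (ρ - 2 / 3 * ρ ^ 3)| ≤ |ρ| ^ 5 := by
  have h := Real.sin_bound (x := 2 * ρ) (by rw [abs_mul, abs_two]; linarith)
  rw [Real.sin_two_mul, abs_mul, abs_two, mul_pow] at h
  rw [abs_le] at h ⊢
  have : 0 ≤ |ρ| ^ 5 := by positivity
  constructor <;> linarith [h.1, h.2]

theorem tendsto_sin_mul_cos_sub_div :
    Tendsto (fun ρ : ℝ => (Real.sin ρ * Real.cos ρ - ρ) / ρ ^ 3) (𝓝[>] 0) (𝓝 (-2 / 3)) := by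
  rw [tendsto_iff_dist_tendsto_zero]
  have hid : Tendsto (fun ρ : ℝ => ρ ^ 2) (𝓝[>] 0) (𝓝 0) :=
    tendsto_nhdsWithin_of_tendsto_nhds ((continuous_pow 2).tendsto' 0 0 (by norm_num))
  refine squeeze_zero' (Eventually.of_forall fun _ => dist_nonneg) ?_ hid
  filter_upwards [Ioo_mem_nhdsGT (show (0 : ℝ) < 1 / 2 by norm_num)] with ρ hρ
  have hρ0 := hρ.1
  have h := abs_sin_mul_cos_sub_le (abs_le.2 ⟨by linarith, hρ.2.le⟩)
  have heq : (Real.sin ρ * Real.cos ρ - ρ) / ρ ^ 3 - -2 / 3 =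
      (Real.sin ρ * Real.cos ρ - (ρ - 2 / 3 * ρ ^ 3)) / ρ ^ 3 := by
    field_simp
    ring
  rw [Real.dist_eq, heq, abs_div, abs_of_pos (pow_pos hρ0 3), div_le_iff₀ (pow_pos hρ0 3)]
  rw [abs_of_pos hρ0] at h
  linarith

theorem tendsto_sin_div_self : Tendsto (fun ρ : ℝ => Real.sin ρ / ρ) (𝓝[>] 0) (𝓝 1) := by
  have h := (Real.hasDerivAt_sin 0).tendsto_slope_zero_right
  simpa [div_eq_inv_mul] using h

theorem deriv_kappa1_div_deriv_kappa2 {ρ : ℝ} (hρ : ρ ∈ Ioo 0 Real.pi) :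
    deriv kappa1 ρ / deriv kappa2 ρ =
      (203 / 8000 * (1 + (ρ / 20 + 203 / 48000 * ρ ^ 3) ^ 2) -
          3 * (1 / 20 + 203 / 48000 * ρ ^ 2) * (1 / 20 + 203 / 16000 * ρ ^ 2) ^ 2) *
        (Real.sin ρ / ρ) ^ 2 /
      ((1 + (ρ / 20 + 203 / 48000 * ρ ^ 3) ^ 2) *
        ((1 / 20 + 203 / 16000 * ρ ^ 2) * ((Real.sin ρ * Real.cos ρ - ρ) / ρ ^ 3) +
          203 / 24000 - (1 / 20 + 203 / 48000 * ρ ^ 2) ^ 3)) := by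
  have hsin := Real.sin_pos_of_mem_Ioo hρ
  have hρ0 := hρ.1
  rw [deriv_kappa1, deriv_kappa2 hsin.ne', deriv_deriv_hFn, deriv_hFn]
  simp only
  have hW : 0 < 1 + (ρ / 20 + 203 / 48000 * ρ ^ 3) ^ 2 := by positivity
  have hs := Real.sqrt_pos.2 hW
  have hsq := Real.sq_sqrt hW.le
  have hnum : 203 / 8000 * ρ * (1 + (ρ / 20 + 203 / 48000 * ρ ^ 3) ^ 2) -
      3 * (ρ / 20 + 203 / 48000 * ρ ^ 3) * (1 / 20 + 203 / 16000 * ρ ^ 2) ^ 2 =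
      ρ * (203 / 8000 * (1 + (ρ / 20 + 203 / 48000 * ρ ^ 3) ^ 2) -
          3 * (1 / 20 + 203 / 48000 * ρ ^ 2) * (1 / 20 + 203 / 16000 * ρ ^ 2) ^ 2) := by
    ring
  have hden : (1 / 20 + 203 / 16000 * ρ ^ 2) * (Real.sin ρ * Real.cos ρ) -
      (ρ / 20 + 203 / 48000 * ρ ^ 3) * (1 + (ρ / 20 + 203 / 48000 * ρ ^ 3) ^ 2) =
      ρ ^ 3 * ((1 / 20 + 203 / 16000 * ρ ^ 2) * ((Real.sin ρ * Real.cos ρ - ρ) / ρ ^ 3) +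
          203 / 24000 - (1 / 20 + 203 / 48000 * ρ ^ 2) ^ 3) := by
    field_simp
    ring
  rw [hnum, hden]
  generalize 203 / 8000 * (1 + (ρ / 20 + 203 / 48000 * ρ ^ 3) ^ 2) -
          3 * (1 / 20 + 203 / 48000 * ρ ^ 2) * (1 / 20 + 203 / 16000 * ρ ^ 2) ^ 2 = A
  generalize (1 / 20 + 203 / 16000 * ρ ^ 2) * ((Real.sin ρ * Real.cos ρ - ρ) / ρ ^ 3) +
          203 / 24000 - (1 / 20 + 203 / 48000 * ρ ^ 2) ^ 3 = B
  generalize √(1 + (ρ / 20 + 203 / 48000 * ρ ^ 3) ^ 2) = s at hs hsq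
  rw [← hsq]
  field_simp

theorem tendsto_deriv_kappa1_div_deriv_kappa2 :
    Tendsto (fun ρ => deriv kappa1 ρ / deriv kappa2 ρ) (𝓝[>] 0) (𝓝 (-1)) := by
  have hpoly : ∀ {f : ℝ → ℝ}, Continuous f → Tendsto f (𝓝[>] 0) (𝓝 (f 0)) := fun hf =>
    tendsto_nhdsWithin_of_tendsto_nhds hf.continuousAt
  have hA := hpoly (f := fun ρ => 203 / 8000 * (1 + (ρ / 20 + 203 / 48000 * ρ ^ 3) ^ 2) -
    3 * (1 / 20 + 203 / 48000 * ρ ^ 2) * (1 / 20 + 203 / 16000 * ρ ^ 2) ^ 2) (by fun_prop)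
  have hW := hpoly (f := fun ρ => 1 + (ρ / 20 + 203 / 48000 * ρ ^ 3) ^ 2) (by fun_prop)
  have hq := hpoly (f := fun ρ => 1 / 20 + 203 / 16000 * ρ ^ 2) (by fun_prop)
  have hu := hpoly (f := fun ρ => (1 / 20 + 203 / 48000 * ρ ^ 2) ^ 3) (by fun_prop)
  have hlim := (hA.mul (tendsto_sin_div_self.pow 2)).div
    (hW.mul (((hq.mul tendsto_sin_mul_cos_sub_div).add_const (203 / 24000)).sub hu))
    (by norm_num)
  norm_num only at hlim
  refine hlim.congr' ?_
  filter_upwards [Ioo_mem_nhdsGT Real.pi_pos] with ρ hρ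
  rw [deriv_kappa1_div_deriv_kappa2 hρ]
  norm_num

/-- The explicit example `h(ρ) = (R/2)ρ² + ((R/6+R³)/8)ρ⁴`, `R = 1/20`, gives an
elliptic Weingarten rotational surface in `S²×ℝ` reaching the antipodal fiber with a
conical singularity. -/
theorem explicit_weingarten_example :
    (hFn 0 = 0 ∧ deriv hFn 0 = 0 ∧ deriv (deriv hFn) 0 = Rconst ∧ 0 < Rconst) ∧
    (∀ ρ ∈ Set.Ioo (0 : ℝ) Real.pi, 0 < deriv (deriv hFn) ρ) ∧
    (∀ ρ ∈ Set.Ioo (0 : ℝ) Real.pi, deriv kappa1 ρ * deriv kappa2 ρ < 0) ∧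
    Tendsto (fun ρ => deriv kappa1 ρ / deriv kappa2 ρ) (𝓝[>] 0) (𝓝 (-1)) := by
  refine ⟨⟨by simp [hFn], by simp [deriv_hFn], by simp [deriv_deriv_hFn, Rconst],
    by norm_num [Rconst]⟩, fun ρ _ => ?_, fun ρ hρ => ?_, tendsto_deriv_kappa1_div_deriv_kappa2⟩
  · rw [deriv_deriv_hFn]
    positivity
  · exact mul_neg_of_pos_of_neg (deriv_kappa1_pos hρ) (deriv_kappa2_neg hρ)
end
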